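/- Let R be a valuation domain with finite total defect d_R(0) < ∞. Then there exists a finite chain of prime ideals P = L_0 ⊃ L_1 ⊃ ... ⊃ L_{m-1} ⊃ L_m ⊇ 0 such that R_{L_k}/L_{k+1} is an almost maximal valuation ring for all 0 ≤ k ≤ m−1, and R_{L_m} is maximal if L_m ≠ 0. -/

import Mathlib

open Pointwise

universe u

/-- Linear compactness of `M` in the discrete topology. -/
def LinearlyCompact (R : Type*) (M : Type*) [CommRing R] [AddCommGroup M]
    [Module R M] : Prop :=
  ∀ (ι : Type) (a : ι → M) (N : ι → Submodule R M),
    (∀ s : Finset ι, ∃ x : M, ∀ i ∈ s, x - a i ∈ N i) →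
    ∃ x : M, ∀ i, x - a i ∈ N i

/-- A maximal valuation ring: linearly compact in the discrete topology. -/
def MaximalRing (R : Type*) [CommRing R] : Prop := LinearlyCompact R R

/-- Almost maximal: every proper quotient by a nonzero ideal is linearly compact. -/
def AlmostMaximalRing (R : Type*) [CommRing R] : Prop :=
  ∀ A : Ideal R, A ≠ ⊥ → LinearlyCompact R (R ⧸ A)

/-- `R/A` is complete in its ideal topology. -/
def CompleteInIdealTopology (R : Type*) [CommRing R] (A : Ideal R) : Prop :=
  ∀ (ι : Type) (a : ι → R) (B : ι → Ideal R),
    (∀ i, A ≤ B i) → (⨅ i, B i) = A →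
    (∀ i j, B i ≤ B j → a i - a j ∈ B j) →
    ∃ x : R, ∀ i, x - a i ∈ B i

/-- The top prime set `M^♯ = {s : sM ⊊ M}` of a module. -/
def sharpSet (R : Type*) (M : Type*) [CommRing R] [AddCommGroup M] [Module R M] : Set R :=
  {s : R | s • (⊤ : Submodule R M) ≠ ⊤}

/-- The top prime set of an ideal. -/
def sharpIdealSet (R : Type*) [CommRing R] (A : Ideal R) : Set R :=
  {s : R | s • A ≠ A}

/-- content ideal of `x` in `U`. -/
def contentIdeal (R : Type*) {U : Type*} [CommRing R] [AddCommGroup U] [Module R U]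
    (x : U) : Ideal R :=
  ⨅ A ∈ {A : Ideal R | x ∈ A • (⊤ : Submodule R U)}, A

/-- uniserial module -/
def IsUniserialModule (R : Type*) (M : Type*) [CommRing R] [AddCommGroup M] [Module R M] : Prop :=
  ∀ N N' : Submodule R M, N ≤ N' ∨ N' ≤ N

/-- relatively divisible (pure) submodule -/
def IsPureSub {R : Type*} {M : Type*} [CommRing R] [AddCommGroup M] [Module R M]
    (B : Submodule R M) : Prop :=
  ∀ (r : R) (x : M), r • x ∈ B → ∃ y ∈ B, r • x = r • y

/-- `S` is a maximal immediate extension of `R`. -/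
def IsMaximalImmediateExt (R S : Type*) [CommRing R] [CommRing S] [Algebra R S] : Prop :=
  Function.Injective (algebraMap R S) ∧
  (∀ s : S, s ≠ 0 → ∃ (r : R) (u : Sˣ), s = algebraMap R S r * u) ∧
  (∀ s : S, ∃ r : R, ¬ IsUnit (s - algebraMap R S r)) ∧
  LinearlyCompact S S

/-- `S` is the completion of `R` in the `R`-topology. -/
def IsRTopCompletion (R S : Type*) [CommRing R] [CommRing S] [Algebra R S] : Prop :=
  Function.Injective (algebraMap R S) ∧
  (∀ s : S, ∀ r : R, r ≠ 0 → ∃ a : R, s - algebraMap R S a ∈ Ideal.span {algebraMap R S r}) ∧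
  (∀ a : R → S,
    (∀ r t : R, r ∈ Ideal.span {t} → a r - a t ∈ Ideal.span {algebraMap R S t}) →
    ∃ s : S, ∀ r : R, r ≠ 0 → s - a r ∈ Ideal.span {algebraMap R S r})

/-- factor of two submodules -/
abbrev quotFactor {R : Type*} {M : Type*} [CommRing R] [AddCommGroup M] [Module R M]
    (H₁ H₂ : Submodule R M) : Type _ :=
  ↥H₂ ⧸ (H₁.comap H₂.subtype)

namespace TD

/-- boundedness of a family of lower sets between two values differing by a power of `ρ` -/
def Bdd {Γ : Type u} [LinearOrderedCommGroupWithZero Γ] {ι : Type} (ρ : Γ) (I : Set ι)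
    (U : ι → Set Γ) : Prop :=
  ∃ (β βu : Γ) (m : ℕ), β ≠ 0 ∧ βu * ρ ^ m ≤ β ∧ ∀ i ∈ I, β ∈ U i ∧ ∀ u ∈ U i, u ≤ βu

/-- completeness of `H` for bounded families of balls indexed by `I` -/
def CompOn {Γ : Type u} [LinearOrderedCommGroupWithZero Γ] {E : Type u} [AddCommGroup E]
    (w : E → Γ) (H : Set E) (ρ : Γ) {ι : Type} (I : Set ι) : Prop :=
  ∀ (U : ι → Set Γ) (x : ι → E), (∀ i ∈ I, IsLowerSet (U i)) → Bdd ρ I U →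
    (∀ i ∈ I, x i ∈ H) → (∀ i ∈ I, ∀ j ∈ I, w (x i - x j) ∈ U i ∪ U j) →
    ∃ y ∈ H, ∀ i ∈ I, w (y - x i) ∈ U i

/-- linear compactness with respect to a valuation -/
def LCV {Γ : Type u} [LinearOrderedCommGroupWithZero Γ] {E : Type u} [AddCommGroup E]
    (w : E → Γ) : Prop :=
  ∀ (ι : Type) (U : ι → Set Γ) (x : ι → E), (∀ i, IsLowerSet (U i)) →
    (∀ i j, w (x i - x j) ∈ U i ∪ U j) → ∃ y, ∀ i, w (y - x i) ∈ U i

section key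

variable {K F : Type u} [Field K] [Field F] [Algebra K F] {Γ : Type u}
  [LinearOrderedCommGroupWithZero Γ]

theorem low_add {U : Set Γ} (hU : IsLowerSet U) {E : Type u} [Ring E] (v : Valuation E Γ) {a b : E}
    (ha : v a ∈ U) (hb : v b ∈ U) : v (a + b) ∈ U := by
  rcases le_total (v a) (v b) with h | h
  · exact hU ((v.map_add a b).trans (max_le h le_rfl)) hb
  · exact hU ((v.map_add a b).trans (max_le le_rfl h)) ha

theorem low_sub {U : Set Γ} (hU : IsLowerSet U) {E : Type u} [Ring E] (v : Valuation E Γ) {a b : E}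
    (ha : v a ∈ U) (hb : v b ∈ U) : v (a - b) ∈ U := by
  rw [sub_eq_add_neg]
  exact low_add hU v ha (by rwa [Valuation.map_neg])

/-- image of the ball of `H` given by `U` -/
def Im (v : Valuation F Γ) (H : Submodule K F) (φ : F →ₗ[K] K) (U : Set Γ) : Set Γ :=
  {γ | ∃ h ∈ H, v h ∈ U ∧ v (algebraMap K F (φ h)) = γ}

variable (v : Valuation F Γ)

theorem v_smul (c : K) (x : F) : v (c • x) = v (algebraMap K F c) * v x := by
  rw [Algebra.smul_def, map_mul]

theorem Im_mono (H : Submodule K F) (φ : F →ₗ[K] K) {U U' : Set Γ} (h : U ⊆ U') :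
    Im v H φ U ⊆ Im v H φ U' := by
  rintro γ ⟨x, hx, h1, h2⟩
  exact ⟨x, hx, h h1, h2⟩

theorem Im_union (H : Submodule K F) (φ : F →ₗ[K] K) {U U' : Set Γ} :
    Im v H φ (U ∪ U') = Im v H φ U ∪ Im v H φ U' := by
  ext γ; constructor
  · rintro ⟨x, hx, h1 | h1, h2⟩
    · exact Or.inl ⟨x, hx, h1, h2⟩
    · exact Or.inr ⟨x, hx, h1, h2⟩
  · rintro (⟨x, hx, h1, h2⟩ | ⟨x, hx, h1, h2⟩)
    · exact ⟨x, hx, Or.inl h1, h2⟩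
    · exact ⟨x, hx, Or.inr h1, h2⟩

theorem Im_mul (hv : ∀ γ, ∃ c : K, v (algebraMap K F c) = γ)
    (H : Submodule K F) (φ : F →ₗ[K] K) {U : Set Γ} (hU : IsLowerSet U) {δ ν : Γ}
    (hδ : δ ∈ U) (hν : ν ∈ Im v H φ (Set.Iic 1)) : δ * ν ∈ Im v H φ U := by
  obtain ⟨h, hh, h1, rfl⟩ := hν
  obtain ⟨c, rfl⟩ := hv δ
  refine ⟨c • h, H.smul_mem c hh, ?_, by simp⟩
  rw [v_smul]
  exact hU (mul_le_of_le_one_right' h1) hδ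

theorem Im_split (hv : ∀ γ, ∃ c : K, v (algebraMap K F c) = γ)
    (H : Submodule K F) (φ : F →ₗ[K] K) {U : Set Γ} {γ : Γ}
    (hγ : γ ∈ Im v H φ U) : ∃ u ∈ U, ∃ ν ∈ Im v H φ (Set.Iic 1), γ = u * ν := by
  obtain ⟨h, hh, h1, rfl⟩ := hγ
  obtain ⟨c, hc⟩ := hv (v h)
  by_cases h0 : h = 0
  · subst h0
    exact ⟨_, h1, 0, ⟨0, H.zero_mem, by simp, by simp⟩, by simp⟩
  have hne : v h ≠ 0 := (Valuation.ne_zero_iff v).2 h0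
  refine ⟨_, h1, _, ⟨c⁻¹ • h, H.smul_mem _ hh, ?_, rfl⟩, ?_⟩
  · rw [v_smul, map_inv₀, map_inv₀, hc]; simp [hne]
  · simp [hc, hne]

theorem Im_lower (hv : ∀ γ, ∃ c : K, v (algebraMap K F c) = γ)
    (H : Submodule K F) (φ : F →ₗ[K] K) {U : Set Γ} (hU : IsLowerSet U) :
    IsLowerSet (Im v H φ U) := by
  rintro γ γ' hle ⟨h, hh, h1, h2⟩
  by_cases h0 : γ = 0
  · have : γ' = γ := by subst h0; exact le_antisymm hle zero_le
    subst this; exact ⟨h, hh, h1, h2⟩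
  obtain ⟨c, hc⟩ := hv (γ' / γ)
  refine ⟨c • h, H.smul_mem c hh, ?_, ?_⟩
  · rw [v_smul, hc]
    exact hU (mul_le_of_le_one_left' (div_le_one_of_le₀ hle zero_le)) h1
  · rw [map_smul, smul_eq_mul, map_mul, map_mul, hc, h2, div_mul_cancel₀ _ h0]

theorem Im_exact (H : Submodule K F) (φ : F →ₗ[K] K) {U : Set Γ} (hU : IsLowerSet U) {k : K}
    (hk : v (algebraMap K F k) ∈ Im v H φ U) : ∃ h ∈ H, v h ∈ U ∧ φ h = k := by
  obtain ⟨h, h1, h2, h3⟩ := hk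
  by_cases h0 : k = 0
  · refine ⟨0, H.zero_mem, ?_, by rw [h0, map_zero]⟩
    exact hU (by simp) h2
  have hne : v (algebraMap K F k) ≠ 0 := by simpa using h0
  have hφh : φ h ≠ 0 := by
    intro h00
    rw [h00, map_zero, map_zero] at h3
    exact hne h3.symm
  refine ⟨(k / φ h) • h, H.smul_mem _ h1, ?_, ?_⟩
  · rw [v_smul, map_div₀, map_div₀, h3, div_self hne, one_mul]; exact h2
  · rw [map_smul, smul_eq_mul, div_mul_cancel₀ _ hφh]

theorem exists_functional [FiniteDimensional K F] (H : Submodule K F) (hH : H ≠ ⊥) :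
    ∃ φ : F →ₗ[K] K, (∀ k, ∃ h ∈ H, φ h = k) ∧
      Module.finrank K ↥(H ⊓ LinearMap.ker φ) < Module.finrank K H := by
  obtain ⟨x, hx, hx0⟩ := (Submodule.ne_bot_iff H).1 hH
  obtain ⟨φ, hφ⟩ := Module.Projective.exists_dual_eq_one K hx0
  refine ⟨φ, fun k => ⟨k • x, H.smul_mem k hx, ?_⟩, ?_⟩
  · rw [map_smul, hφ, smul_eq_mul, mul_one]
  · apply Submodule.finrank_lt_finrank_of_lt
    refine lt_of_le_of_ne inf_le_left fun h => ?_
    have : x ∈ H ⊓ LinearMap.ker φ := by rw [h]; exact hx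
    have h2 := this.2
    have h3 : φ x = 0 := h2
    rw [hφ] at h3
    exact one_ne_zero h3

/-- Completeness of `K` passes to all finite dimensional subspaces. -/
theorem comp_sub [FiniteDimensional K F] (hv : ∀ γ, ∃ c : K, v (algebraMap K F c) = γ)
    {ι : Type} (I : Set ι) {ρ : Γ} (hρ0 : ρ ≠ 0)
    (hK : CompOn (fun c : K => v (algebraMap K F c)) Set.univ ρ I) :
    ∀ (n : ℕ) (H : Submodule K F), Module.finrank K H = n → CompOn v (H : Set F) ρ I := by
  intro n
  induction n using Nat.strong_induction_on with
  | _ n ih =>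
  intro H hn U x hU hB hx hcoh
  by_cases hH : H = ⊥
  · subst hH
    refine ⟨0, Submodule.zero_mem _, fun i hi => ?_⟩
    have h1 := hcoh i hi i hi
    have h2 : x i = 0 := by simpa using hx i hi
    simpa [h2] using h1
  by_cases hI : I = ∅
  · subst hI
    exact ⟨0, H.zero_mem, by simp⟩
  obtain ⟨i0, hi0⟩ := Set.nonempty_iff_ne_empty.2 hI
  obtain ⟨φ, hsurj, hlt⟩ := exists_functional H hH
  have hcohK : ∀ i ∈ I, ∀ j ∈ I, v (algebraMap K F (φ (x i) - φ (x j))) ∈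
      Im v H φ (U i) ∪ Im v H φ (U j) := by
    intro i hi j hj
    rw [← Im_union]
    exact ⟨x i - x j, H.sub_mem (hx i hi) (hx j hj), hcoh i hi j hj, by rw [map_sub]⟩
  have hk : ∃ k : K, ∀ i ∈ I, v (algebraMap K F (k - φ (x i))) ∈ Im v H φ (U i) := by
    obtain ⟨β, β', m, hβ, hββ, hb⟩ := hB
    by_cases hN : ∃ ν0 ∈ Im v H φ (Set.Iic 1), ∀ ν ∈ Im v H φ (Set.Iic 1), ρ * ν < ν0
    · obtain ⟨ν0, hν0, hνlt⟩ := hN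
      have hν00 : ν0 ≠ 0 := (lt_of_le_of_lt zero_le (hνlt ν0 hν0)).ne'
      have hBN : Bdd ρ I (fun i => Im v H φ (U i)) := by
        refine ⟨β * ν0, β' * (ρ⁻¹ * ν0), m + 1, mul_ne_zero hβ hν00, ?_, fun i hi => ⟨?_, ?_⟩⟩
        · calc β' * (ρ⁻¹ * ν0) * ρ ^ (m + 1) = (β' * ρ ^ m) * ν0 * (ρ⁻¹ * ρ) := by
                rw [pow_succ]; ac_rfl
            _ = (β' * ρ ^ m) * ν0 := by rw [inv_mul_cancel₀ hρ0, mul_one]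
            _ ≤ β * ν0 := by gcongr
        · exact Im_mul v hv H φ (hU i hi) (hb i hi).1 hν0
        · intro u hu
          obtain ⟨a, ha, ν, hν, rfl⟩ := Im_split v hv H φ hu
          have h1 := (hb i hi).2 a ha
          have h2 : ν ≤ ρ⁻¹ * ν0 := by
            rw [le_inv_mul_iff₀ (zero_lt_iff.2 hρ0)]
            exact (hνlt ν hν).le
          exact mul_le_mul' h1 h2
      obtain ⟨k, -, hk⟩ := hK (fun i => Im v H φ (U i)) (fun i => φ (x i))
        (fun i hi => Im_lower v hv H φ (hU i hi)) hBN (fun _ _ => Set.mem_univ _) hcohK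
      exact ⟨k, hk⟩
    · push Not at hN
      have hpow : ∀ (m : ℕ), ∀ ν0 ∈ Im v H φ (Set.Iic 1), ∃ ν ∈ Im v H φ (Set.Iic 1),
          ν0 ≤ ρ ^ m * ν := by
        intro m
        induction m with
        | zero => intro ν hν; exact ⟨ν, hν, by simp⟩
        | succ m ihm =>
          intro ν hν
          obtain ⟨ν1, h1, h2⟩ := ihm ν hν
          obtain ⟨ν2, h3, h4⟩ := hN ν1 h1
          refine ⟨ν2, h3, h2.trans ?_⟩
          rw [pow_succ, mul_assoc]
          gcongr
      have hall : ∀ i ∈ I, ∀ j ∈ I, Im v H φ (U i) ⊆ Im v H φ (U j) := by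
        intro i hi j hj γ hγ
        obtain ⟨a, ha, ν, hν, rfl⟩ := Im_split v hv H φ hγ
        obtain ⟨ν1, h1, h2⟩ := hpow m ν hν
        refine Im_lower v hv H φ (hU j hj) ?_ (Im_mul v hv H φ (hU j hj) (hb j hj).1 h1)
        calc a * ν ≤ β' * (ρ ^ m * ν1) := mul_le_mul' ((hb i hi).2 a ha) h2
          _ = β' * ρ ^ m * ν1 := by rw [mul_assoc]
          _ ≤ β * ν1 := by gcongr
      refine ⟨φ (x i0), fun i hi => ?_⟩
      rcases hcohK i0 hi0 i hi with h | h
      · exact hall i0 hi0 i hi h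
      · exact h
  obtain ⟨k, hk⟩ := hk
  obtain ⟨z, hz, rfl⟩ := hsurj k
  have hh : ∀ i, ∃ h : F, i ∈ I → h ∈ H ∧ v h ∈ U i ∧ φ h = φ z - φ (x i) := by
    intro i
    by_cases hi : i ∈ I
    · obtain ⟨h, h1, h2, h3⟩ := Im_exact v H φ (hU i hi) (hk i hi)
      exact ⟨h, fun _ => ⟨h1, h2, by rw [h3]⟩⟩
    · exact ⟨0, fun h => absurd h hi⟩
  choose h hh using hh
  obtain ⟨w, hw, hw2⟩ := ih _ (hn ▸ hlt) (H ⊓ LinearMap.ker φ) rfl U (fun i => z - x i - h i) hU hB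
    (fun i hi => ⟨H.sub_mem (H.sub_mem hz (hx i hi)) (hh i hi).1, by
      simp [LinearMap.mem_ker, (hh i hi).2.2]⟩)
    (fun i hi j hj => by
      have e : z - x i - h i - (z - x j - h j) = (h j - h i) - (x i - x j) := by ring
      rw [e]
      have hl := (hU i hi).union (hU j hj)
      exact low_sub hl v (low_sub hl v (Or.inr (hh j hj).2.1) (Or.inl (hh i hi).2.1))
        (hcoh i hi j hj))
  refine ⟨z - w, H.sub_mem hz hw.1, fun i hi => ?_⟩
  have e : z - w - x i = h i - (w - (z - x i - h i)) := by ring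
  rw [e]
  exact low_sub (hU i hi) v (hh i hi).2.1 (hw2 i hi)

/-- recursion principle -/
theorem exists_rec {ι : Type} {X : Type u} [Nonempty X] (r : ι → ι → Prop) (hr : WellFounded r)
    (Q : ι → X → Prop) (C : ι → ι → X → X → Prop)
    (step : ∀ (i : ι) (f : ι → X), (∀ j, r j i → Q j (f j)) →
      (∀ j k, r j i → r k i → r k j → C k j (f k) (f j)) →
      ∃ y, Q i y ∧ ∀ j, r j i → C j i (f j) y) :
    ∃ f : ι → X, (∀ i, Q i (f i)) ∧ ∀ i j, r j i → C j i (f j) (f i) := by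
  classical
  let f : ι → X := hr.fix (fun i rec =>
    if h : ∃ y, Q i y ∧ ∀ j (hj : r j i), C j i (rec j hj) y then h.choose
    else Classical.arbitrary X)
  have hf : ∀ i, f i = if h : ∃ y, Q i y ∧ ∀ j, r j i → C j i (f j) y then h.choose
    else Classical.arbitrary X := fun i => hr.fix_eq _ i
  have key : ∀ i, Q i (f i) ∧ ∀ j, r j i → C j i (f j) (f i) := by
    intro i
    induction i using hr.induction with
    | _ i ih =>
    have h := step i f (fun j hj => (ih j hj).1) (fun j k hj _ hkj => (ih j hj).2 k hkj)
    rw [hf i, dif_pos h]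
    exact h.choose_spec
  exact ⟨f, fun i => (key i).1, fun i j h => (key i).2 j h⟩

/-- `H` is dense up to the factor `ρ`. -/
def Dense (H : Submodule K F) (ρ : Γ) : Prop := ∀ x : F, ∃ h ∈ H, v (x - h) ≤ ρ * v x

theorem Dense.pow {H : Submodule K F} {ρ : Γ} (h : Dense v H ρ) (m : ℕ) : Dense v H (ρ ^ m) := by
  induction m with
  | zero => intro x; exact ⟨0, H.zero_mem, by simp⟩
  | succ m ih =>
    intro x
    obtain ⟨y, hy, h1⟩ := ih x
    obtain ⟨z, hz, h2⟩ := h (x - y)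
    refine ⟨y + z, H.add_mem hy hz, ?_⟩
    rw [← sub_sub, pow_succ', mul_assoc]
    exact h2.trans (by gcongr)

/-- The minimal dense subspace. -/
theorem exists_dense [FiniteDimensional K F] (hv : ∀ γ, ∃ c : K, v (algebraMap K F c) = γ)
    {ρ₀ : Γ} (h0 : ρ₀ ≠ 0) (h1 : ρ₀ < 1) :
    ∃ (ρ : Γ) (H : Submodule K F) (φ : F →ₗ[K] K), ρ ≠ 0 ∧ ρ < 1 ∧ Dense v H ρ ∧
      (∀ k, ∃ h ∈ H, φ h = k) ∧
      ∀ t < 1, ∃ ν0 ∈ Im v H φ (Set.Iic 1), ∀ ν ∈ Im v H φ (Set.Iic 1), t * ν < ν0 := by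
  classical
  let p : ℕ → Prop := fun n => ∃ (H : Submodule K F) (ρ : Γ), Module.finrank K H = n ∧ ρ ≠ 0 ∧
    ρ < 1 ∧ Dense v H ρ
  have hp : ∃ n, p n := ⟨_, ⊤, ρ₀, rfl, h0, h1, fun x => ⟨x, trivial, by simp⟩⟩
  obtain ⟨H, ρ, hn, hρ0, hρ1, hd⟩ := Nat.find_spec hp
  have hH : H ≠ ⊥ := by
    rintro rfl
    obtain ⟨h, hh, hle⟩ := hd 1
    rw [Submodule.mem_bot] at hh
    subst hh
    simp at hle
    exact absurd hρ1 (not_lt.2 hle)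
  obtain ⟨φ, hsurj, hlt⟩ := exists_functional H hH
  refine ⟨ρ, H, φ, hρ0, hρ1, hd, hsurj, fun t ht => ?_⟩
  by_contra hcon
  push Not at hcon
  refine Nat.find_min hp (hn ▸ hlt) ⟨H ⊓ LinearMap.ker φ, max ρ t, rfl, ?_, max_lt hρ1 ht, ?_⟩
  · exact (lt_of_lt_of_le (zero_lt_iff.2 hρ0) (le_max_left _ _)).ne'
  have hstep : ∀ h ∈ H, ∃ h' ∈ H ⊓ LinearMap.ker φ, v (h - h') ≤ max ρ t * v h := by
    intro h hh
    by_cases hφ : φ h = 0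
    · exact ⟨h, ⟨hh, hφ⟩, by simp⟩
    have hh0 : h ≠ 0 := by rintro rfl; simp at hφ
    have hvh : v h ≠ 0 := (Valuation.ne_zero_iff v).2 hh0
    obtain ⟨c, hc⟩ := hv (v h)
    have hc0 : c ≠ 0 := by rintro rfl; simp at hc; exact hvh hc.symm
    obtain ⟨_, ⟨g, hg, hg1, rfl⟩, hle⟩ := hcon (v (algebraMap K F (φ (c⁻¹ • h))))
      ⟨c⁻¹ • h, H.smul_mem _ hh, by
        rw [v_smul, map_inv₀, map_inv₀, hc]; simp [hvh], rfl⟩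
    have hφ' : φ (c⁻¹ • h) ≠ 0 := by simp [hφ, hc0]
    have hpos : 0 < v (algebraMap K F (φ (c⁻¹ • h))) := by
      rw [zero_lt_iff]; simpa using ⟨hc0, hφ⟩
    have hg0 : φ g ≠ 0 := by
      intro h00; rw [h00] at hle; simp at hle; rcases hle with h | h
      · exact hc0 h
      · exact hφ h
    have hvg0 : 0 < v (algebraMap K F (φ g)) := by rw [zero_lt_iff]; simpa using hg0
    refine ⟨h - (c * (φ (c⁻¹ • h) / φ g)) • g, ⟨H.sub_mem hh (H.smul_mem _ hg), ?_⟩, ?_⟩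
    · change φ _ = 0
      rw [map_sub, map_smul, map_smul, smul_eq_mul, smul_eq_mul]
      field_simp
      simp
    · rw [sub_sub_cancel, v_smul, map_mul, map_mul, hc, map_div₀, map_div₀]
      calc _ ≤ v h * t * 1 := by
            gcongr
            · rw [div_le_iff₀ hvg0]; exact hle
            · exact hg1
        _ ≤ _ := by rw [mul_one, mul_comm]; gcongr; exact le_max_right _ _
  intro x
  obtain ⟨h, hh, hle⟩ := hd x
  obtain ⟨h', hh', hle'⟩ := hstep h hh
  have hvh : v h ≤ v x := by
    have : h = x - (x - h) := by ring
    rw [this]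
    refine (v.map_sub _ _).trans (max_le le_rfl (hle.trans ?_))
    exact mul_le_of_le_one_left' hρ1.le
  refine ⟨h', hh', ?_⟩
  have : x - h' = (x - h) + (h - h') := by ring
  rw [this]
  refine (v.map_add _ _).trans (max_le (hle.trans ?_) (hle'.trans ?_))
  · gcongr; exact le_max_left _ _
  · gcongr

/-- the inductive step: lifting along the functional -/
theorem comp_step [FiniteDimensional K F] (hv : ∀ γ, ∃ c : K, v (algebraMap K F c) = γ)
    (hLC : LCV v) {ρ : Γ} (hρ0 : ρ ≠ 0) (hρ1 : ρ < 1) (H : Submodule K F) (φ : F →ₗ[K] K)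
    (hd : Dense v H ρ) (hsurj : ∀ k, ∃ h ∈ H, φ h = k)
    (hN : ∀ t < 1, ∃ ν0 ∈ Im v H φ (Set.Iic 1), ∀ ν ∈ Im v H φ (Set.Iic 1), t * ν < ν0)
    {ι : Type} (r : ι → ι → Prop) (hr : IsWellOrder ι r) (I : Set ι)
    (hI : ∀ i ∈ I, ∀ j, r j i → j ∈ I)
    (ih : ∀ i ∈ I, CompOn (fun c : K => v (algebraMap K F c)) Set.univ ρ {j | r j i}) :
    CompOn (fun c : K => v (algebraMap K F c)) Set.univ ρ I := by
  intro U a hU hB _ hcoh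
  by_cases hIe : I = ∅
  · subst hIe
    exact ⟨0, trivial, by simp⟩
  obtain ⟨i0, hi0⟩ := Set.nonempty_iff_ne_empty.2 hIe
  by_cases hmin : ∃ i ∈ I, ∀ j ∈ I, U i ⊆ U j
  · obtain ⟨i, hi, hij⟩ := hmin
    refine ⟨a i, trivial, fun j hj => ?_⟩
    rcases hcoh i hi j hj with h | h
    · exact hij j hj h
    · exact h
  push Not at hmin
  obtain ⟨β, β', m, hβ, hββ, hb⟩ := hB
  obtain ⟨ν0, hν0, hνlt⟩ := hN ρ hρ1
  have hν00 : ν0 ≠ 0 := (lt_of_le_of_lt zero_le (hνlt ν0 hν0)).ne'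
  have hνpos : 0 < ν0 := zero_lt_iff.2 hν00
  let D : ι → Set Γ := fun i => {δ | ∀ ν ∈ Im v H φ (Set.Iic 1), δ * ν ∈ U i}
  have hDl : ∀ i ∈ I, IsLowerSet (D i) := by
    intro i hi δ δ' hle hδ ν hν
    exact hU i hi (mul_le_mul_left hle ν) (hδ ν hν)
  have hDN : ∀ i ∈ I, Im v H φ (D i) ⊆ U i := by
    intro i hi γ hγ
    obtain ⟨u, hu, ν, hν, rfl⟩ := Im_split v hv H φ hγ
    exact hu ν hν
  have hDlow : ∀ i ∈ I, ρ * β / ν0 ∈ D i := by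
    intro i hi ν hν
    refine hU i hi ?_ (hb i hi).1
    rw [div_mul_eq_mul_div, div_le_iff₀ hνpos]
    calc ρ * β * ν = β * (ρ * ν) := by ac_rfl
      _ ≤ β * ν0 := by gcongr; exact (hνlt ν hν).le
  have hDup : ∀ i ∈ I, ∀ u ∈ D i, u ≤ β' / ν0 := by
    intro i hi u hu
    rw [le_div_iff₀ hνpos]
    exact (hb i hi).2 _ (hu ν0 hν0)
  have hjump : ∀ i, ∃ j, i ∈ I → j ∈ I ∧ U j ⊆ Im v H φ (D i) ∧ U j ⊆ U i := by
    intro i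
    by_cases hi : i ∈ I
    swap
    · exact ⟨i, fun h => absurd h hi⟩
    obtain ⟨j, hj, hij⟩ := hmin i hi
    obtain ⟨u, hu, huj⟩ := Set.not_subset.1 hij
    have hlt : ∀ w ∈ U j, w < u := fun w hw => by
      by_contra hcon
      exact huj (hU j hj (not_lt.1 hcon) hw)
    refine ⟨j, fun _ => ⟨hj, fun w hw => ?_, fun w hw => hU i hi (hlt w hw).le hu⟩⟩
    have hup : 0 < u := lt_of_le_of_lt zero_le (hlt w hw)
    obtain ⟨ν, hν, hνt⟩ := hN (w / u) ((div_lt_one₀ hup).2 (hlt w hw))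
    have hνp : 0 < ν := lt_of_le_of_lt zero_le (hνt ν hν)
    have e : w = (w / ν) * ν := by rw [div_mul_cancel₀ _ hνp.ne']
    rw [e]
    refine Im_mul v hv H φ (hDl i hi) ?_ hν
    intro ν' hν'
    refine hU i hi ?_ hu
    have h1 := (hνt ν' hν').le
    rw [div_mul_eq_mul_div, div_le_iff₀ hup] at h1
    rw [div_mul_eq_mul_div, div_le_iff₀ hνp, mul_comm u]
    exact h1
  choose J hJ using hjump
  have hacoh : ∀ i ∈ I, ∀ k ∈ I, v (algebraMap K F (a (J i) - a (J k))) ∈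
      Im v H φ (D i ∪ D k) := by
    intro i hi k hk
    rw [Im_union]
    rcases hcoh (J i) (hJ i hi).1 (J k) (hJ k hk).1 with h | h
    · exact Or.inl ((hJ i hi).2.1 h)
    · exact Or.inr ((hJ k hk).2.1 h)
  obtain ⟨x, hx, hxc⟩ := exists_rec r hr.wf
    (fun i y => i ∈ I → y ∈ H ∧ φ y = a (J i))
    (fun k i y z => i ∈ I → v (z - y) ∈ D i ∪ D k) (by
      intro i f hf hfc
      by_cases hi : i ∈ I
      swap
      · exact ⟨(0 : F), fun h => absurd h hi, fun _ _ h => absurd h hi⟩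
      obtain ⟨z, hz, hza⟩ := hsurj (a (J i))
      have hsub : ∀ k ∈ {j | r j i}, k ∈ I := fun k hk => hI i hi k hk
      have hh : ∀ k, ∃ h : F, r k i → h ∈ H ∧ v h ∈ D i ∪ D k ∧ φ h = a (J i) - a (J k) := by
        intro k
        by_cases hk : r k i
        · have hkI := hsub k hk
          obtain ⟨h, h1⟩ := Im_exact v H φ ((hDl i hi).union (hDl k hkI)) (hacoh i hi k hkI)
          exact ⟨h, fun _ => h1⟩
        · exact ⟨0, fun h => absurd h hk⟩
      choose h hh using hh
      obtain ⟨w, hw, hw2⟩ := comp_sub v hv {j | r j i} hρ0 (ih i hi) _ (H ⊓ LinearMap.ker φ) rfl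
        (fun k => D i ∪ D k) (fun k => z - f k - h k)
        (fun k hk => (hDl i hi).union (hDl k (hsub k hk)))
        (by
          refine ⟨ρ * β / ν0, β' / ν0, m + 1, div_ne_zero (mul_ne_zero hρ0 hβ) hν00, ?_,
            fun k hk => ⟨Or.inl (hDlow i hi), ?_⟩⟩
          · rw [div_mul_eq_mul_div]
            refine div_le_div_of_nonneg_right ?_ zero_le
            calc β' * ρ ^ (m + 1) = ρ * (β' * ρ ^ m) := by rw [pow_succ]; ac_rfl
              _ ≤ ρ * β := by gcongr
          · rintro u (hu | hu)
            · exact hDup i hi u hu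
            · exact hDup k (hsub k hk) u hu)
        (fun k hk => ⟨H.sub_mem (H.sub_mem hz (hf k hk (hsub k hk)).1) (hh k hk).1, by
          change φ _ = 0
          rw [map_sub, map_sub, hza, (hf k hk (hsub k hk)).2, (hh k hk).2.2, sub_self]⟩)
        (by
          intro k hk l hl
          have e : z - f k - h k - (z - f l - h l) = (h l - h k) - (f k - f l) := by ring
          have hlow : IsLowerSet ((D i ∪ D k) ∪ (D i ∪ D l)) :=
            ((hDl i hi).union (hDl k (hsub k hk))).union ((hDl i hi).union (hDl l (hsub l hl)))
          rw [e]
          refine low_sub hlow v (low_sub hlow v (Or.inr (hh l hl).2.1) (Or.inl (hh k hk).2.1)) ?_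
          rcases trichotomous_of r k l with hkl | hkl | hkl
          · rw [Valuation.map_sub_swap]
            rcases hfc l k hl hk hkl (hsub l hl) with h | h
            · exact Or.inr (Or.inr h)
            · exact Or.inl (Or.inr h)
          · subst hkl
            rw [sub_self, map_zero]
            exact Or.inl (Or.inl (hDl i hi zero_le (hDlow i hi)))
          · rcases hfc k l hk hl hkl (hsub k hk) with h | h
            · exact Or.inl (Or.inr h)
            · exact Or.inr (Or.inr h))
      refine ⟨z - w, fun _ => ⟨H.sub_mem hz hw.1, ?_⟩, fun k hk _ => ?_⟩
      · have : φ w = 0 := hw.2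
        rw [map_sub, hza, this, sub_zero]
      · have e : z - w - f k = h k - (w - (z - f k - h k)) := by ring
        rw [e]
        exact low_sub ((hDl i hi).union (hDl k (hsub k hk))) v (hh k hk).2.1 (hw2 k hk))
  obtain ⟨y, hy⟩ := hLC I (fun i => D i) (fun i => x i) (fun i => hDl i i.2) (by
    rintro ⟨i, hi⟩ ⟨k, hk⟩
    change v (x i - x k) ∈ D i ∪ D k
    rcases trichotomous_of r i k with hik | hik | hik
    · rw [Valuation.map_sub_swap, Set.union_comm]
      exact hxc k i hik hk
    · subst hik
      rw [sub_self, map_zero]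
      exact Or.inl (hDl i hi zero_le (hDlow i hi))
    · exact hxc i k hik hi)
  have hy' : ∀ i (hi : i ∈ I), v (y - x i) ∈ D i := fun i hi => hy ⟨i, hi⟩
  obtain ⟨g, hg, hgle⟩ := hd.pow v (m + 1) (y - x i0)
  have hgle2 : v (y - x i0 - g) ≤ ρ * β / ν0 := by
    refine hgle.trans ?_
    calc ρ ^ (m + 1) * v (y - x i0) ≤ ρ ^ (m + 1) * (β' / ν0) := by
          gcongr; exact hDup i0 hi0 _ (hy' i0 hi0)
      _ = ρ * (β' * ρ ^ m) / ν0 := by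
          rw [pow_succ, div_eq_mul_inv, div_eq_mul_inv]; ac_rfl
      _ ≤ ρ * β / ν0 := by gcongr
  refine ⟨φ (x i0 + g), trivial, fun i hi => ?_⟩
  have h1 : v (x i0 + g - x i) ∈ D i := by
    have e : x i0 + g - x i = (y - x i) - (y - x i0 - g) := by ring
    rw [e]
    exact low_sub (hDl i hi) v (hy' i hi) (hDl i hi hgle2 (hDlow i hi))
  have h2 : v (algebraMap K F (φ (x i0 + g) - a (J i))) ∈ U i :=
    hDN i hi ⟨x i0 + g - x i, H.sub_mem (H.add_mem (hx i0 hi0).1 hg) (hx i hi).1, h1, by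
      rw [map_sub φ, (hx i hi).2]⟩
  have h3 : v (algebraMap K F (a (J i) - a i)) ∈ U i := by
    rcases hcoh (J i) (hJ i hi).1 i hi with h | h
    · exact (hJ i hi).2.2 h
    · exact h
  have e : φ (x i0 + g) - a i = (φ (x i0 + g) - a (J i)) + (a (J i) - a i) := by ring
  change v (algebraMap K F (φ (x i0 + g) - a i)) ∈ U i
  rw [e, map_add]
  exact low_add (hU i hi) v h2 h3

/-- Key lemma: some nontrivial quotient of the valuation ring of `K` is linearly compact. -/
theorem key [FiniteDimensional K F] (hv : ∀ γ, ∃ c : K, v (algebraMap K F c) = γ)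
    (hLC : LCV v) {ρ₀ : Γ} (h0 : ρ₀ ≠ 0) (h1 : ρ₀ < 1) :
    ∃ ρ : Γ, ρ ≠ 0 ∧ ρ < 1 ∧ ∀ ι : Type,
      CompOn (fun c : K => v (algebraMap K F c)) Set.univ ρ (Set.univ : Set ι) := by
  obtain ⟨ρ, H, φ, hρ0, hρ1, hd, hsurj, hN⟩ := exists_dense v hv h0 h1
  refine ⟨ρ, hρ0, hρ1, fun ι => ?_⟩
  have hr : IsWellOrder ι WellOrderingRel := inferInstance
  have hall : ∀ i : ι, CompOn (fun c : K => v (algebraMap K F c)) Set.univ ρ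
      {j | WellOrderingRel j i} := by
    intro i
    induction i using hr.wf.induction with
    | _ i ih =>
    exact comp_step v hv hLC hρ0 hρ1 H φ hd hsurj hN WellOrderingRel hr _
      (fun j hj k hk => trans_of WellOrderingRel hk hj) (fun j hj => ih j hj)
  exact comp_step v hv hLC hρ0 hρ1 H φ hd hsurj hN WellOrderingRel hr _
    (fun _ _ _ _ => trivial) (fun j _ => hall j)

end key
end TD
namespace TD

section lin

theorem tot {A E : Type*} [CommRing A] [IsDomain A] [ValuationRing A] [Field E] [Algebra A E]
    [IsFractionRing A E] (N N' : Submodule A E) : N ≤ N' ∨ N' ≤ N := by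
  by_contra hcon
  push Not at hcon
  obtain ⟨x, hx, hx'⟩ := SetLike.not_le_iff_exists.1 hcon.1
  obtain ⟨y, hy, hy'⟩ := SetLike.not_le_iff_exists.1 hcon.2
  have hx0 : x ≠ 0 := by rintro rfl; exact hx' N'.zero_mem
  have hy0 : y ≠ 0 := by rintro rfl; exact hy' N.zero_mem
  rcases ValuationRing.isInteger_or_isInteger A (x / y) with ⟨a, ha⟩ | ⟨a, ha⟩
  · apply hx'
    have : x = a • y := by rw [Algebra.smul_def, ha, div_mul_cancel₀ _ hy0]
    rw [this]; exact N'.smul_mem a hy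
  · apply hy'
    have : y = a • x := by rw [Algebra.smul_def, ha, inv_div, div_mul_cancel₀ _ hx0]
    rw [this]; exact N.smul_mem a hx

theorem mem_sup_tot {A E : Type*} [CommRing A] [IsDomain A] [ValuationRing A] [Field E]
    [Algebra A E] [IsFractionRing A E] {N N' : Submodule A E} {x : E} (h : x ∈ N ⊔ N') :
    x ∈ N ∨ x ∈ N' := by
  rcases tot N N' with h' | h'
  · rw [sup_eq_right.2 h'] at h; exact Or.inr h
  · rw [sup_eq_left.2 h'] at h; exact Or.inl h

theorem le_of_notMem {A E : Type*} [CommRing A] [IsDomain A] [ValuationRing A] [Field E]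
    [Algebra A E] [IsFractionRing A E] {N : Submodule A E} {x : E} (h : x ∉ N) {y : E}
    (hy : y ∈ N) : ∃ a : A, a • x = y := by
  rcases tot N (Submodule.span A {x}) with h' | h'
  · exact Submodule.mem_span_singleton.1 (h' hy)
  · exact absurd (h' (Submodule.mem_span_singleton_self x)) h

theorem fin_cons {A E : Type*} [CommRing A] [AddCommGroup E] [Module A E] {ι : Type}
    (x : ι → E) (N : ι → Submodule A E) (htot : ∀ i j, N i ≤ N j ∨ N j ≤ N i)
    (hcoh : ∀ i j, x i - x j ∈ N i ∨ x i - x j ∈ N j) (s : Finset ι) :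
    ∃ y, ∀ i ∈ s, y - x i ∈ N i := by
  classical
  have hmin : ∀ s : Finset ι, s.Nonempty → ∃ i ∈ s, ∀ j ∈ s, N i ≤ N j := by
    intro s hs
    induction hs using Finset.Nonempty.cons_induction with
    | singleton a => exact ⟨a, by simp, by simp⟩
    | cons a s ha hs ih =>
      obtain ⟨i, hi, hij⟩ := ih
      rcases htot a i with h | h
      · refine ⟨a, by simp, fun j hj => ?_⟩
        rcases Finset.mem_cons.1 hj with rfl | hj
        · exact le_rfl
        · exact h.trans (hij j hj)
      · refine ⟨i, by simp [hi], fun j hj => ?_⟩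
        rcases Finset.mem_cons.1 hj with rfl | hj
        · exact h
        · exact hij j hj
  rcases s.eq_empty_or_nonempty with rfl | hs
  · exact ⟨0, by simp⟩
  obtain ⟨i, hi, hij⟩ := hmin s hs
  refine ⟨x i, fun j hj => ?_⟩
  rcases hcoh i j with h | h
  · exact hij j hj h
  · exact h

theorem lcF {A E : Type u} [CommRing A] [IsDomain A] [ValuationRing A] [Field E] [Algebra A E]
    [IsFractionRing A E] (hA : LinearlyCompact A A) (ι : Type) (W : ι → Submodule A E) (x : ι → E)
    (hcoh : ∀ i j, x i - x j ∈ W i ⊔ W j) : ∃ y, ∀ i, y - x i ∈ W i := by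
  by_cases htop : ∀ i, W i = ⊤
  · exact ⟨0, fun i => by rw [htop i]; trivial⟩
  push Not at htop
  obtain ⟨i0, hi0⟩ := htop
  obtain ⟨f, -, hf⟩ := SetLike.exists_of_lt (lt_top_iff_ne_top.2 hi0)
  have ha : ∀ i, ∃ a : A, x i - x i0 - a • f ∈ W i := by
    intro i
    rcases mem_sup_tot (hcoh i i0) with h | h
    · exact ⟨0, by simpa using h⟩
    · obtain ⟨a, ha⟩ := le_of_notMem hf h
      exact ⟨a, by rw [ha, sub_self]; exact (W i).zero_mem⟩
  choose a ha using ha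
  obtain ⟨y, hy⟩ := hA ι a (fun i => (W i).comap (LinearMap.toSpanSingleton A E f)) (by
    apply fin_cons
    · intro i j
      rcases tot (W i) (W j) with h | h
      · exact Or.inl (Submodule.comap_mono h)
      · exact Or.inr (Submodule.comap_mono h)
    · intro i j
      have h : (a i - a j) • f ∈ W i ⊔ W j := by
        have e : (a i - a j) • f = (x i - x j) - (x i - x i0 - a i • f) + (x j - x i0 - a j • f) := by
          rw [sub_smul]; abel
        rw [e]
        exact add_mem (sub_mem (hcoh i j) (Submodule.mem_sup_left (ha i)))
          (Submodule.mem_sup_right (ha j))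
      rcases mem_sup_tot h with h | h
      · exact Or.inl h
      · exact Or.inr h)
  refine ⟨x i0 + y • f, fun i => ?_⟩
  have h1 : (y - a i) • f ∈ W i := hy i
  have e : x i0 + y • f - x i = (y - a i) • f - (x i - x i0 - a i • f) := by
    rw [sub_smul]; abel
  rw [e]
  exact sub_mem h1 (ha i)

end lin

section prime

variable {R : Type u} [CommRing R] [IsDomain R] [ValuationRing R] {K : Type u} [Field K]
  [Algebra R K] [IsFractionRing R K]

/-- stability under division by elements outside `L` -/
def Stab (L : Ideal R) (N : Submodule R K) : Prop := ∀ s, s ∉ L → ∀ x, s • x ∈ N → x ∈ N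

/-- membership in the localization at `L` -/
def InL (L : Ideal R) (k : K) : Prop := ∃ s, s ∉ L ∧ ∃ r : R, s • k = algebraMap R K r

/-- linear compactness of `R_L` for submodules containing `T` -/
def LCK (L : Ideal R) (T : Set K) : Prop :=
  ∀ (ι : Type) (x : ι → K) (N : ι → Submodule R K), (∀ i, Stab L (N i)) →
    (∀ i, ∀ t ∈ T, t ∈ N i) → (∀ i, ∀ n ∈ N i, InL L n) →
    (∀ i j, x i - x j ∈ N i ⊔ N j) → ∃ y, ∀ i, y - x i ∈ N i

theorem LCK.scale {L : Ideal R} {T : Set K} (h : LCK L T) {c : K} (hc : c ≠ 0) {ι : Type}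
    (x : ι → K) (N : ι → Submodule R K) (hst : ∀ i, Stab L (N i)) (i0 : ι)
    (hT : ∀ j, N j ≤ N i0 → ∀ t ∈ T, c * t ∈ N j) (hn : ∀ n ∈ N i0, InL L (c⁻¹ * n))
    (hcoh : ∀ i j, x i - x j ∈ N i ⊔ N j) : ∃ y, ∀ i, y - x i ∈ N i := by
  obtain ⟨y, hy⟩ := h {j // N j ≤ N i0} (fun j => c⁻¹ * x j)
    (fun j => (N j).comap (LinearMap.mulLeft R c)) (by
      intro j s hs z hz
      refine hst j s hs _ ?_
      simpa using hz) (fun j t ht => hT j j.2 t ht) (by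
      intro j n hjn
      have := hn (c * n) (j.2 hjn)
      rwa [inv_mul_cancel_left₀ hc] at this) (by
      intro i j
      have h1 : ∀ j, c * (c⁻¹ * x i - c⁻¹ * x j) = x i - x j := by
        intro j; field_simp
      rcases mem_sup_tot (hcoh i j) with h | h
      · refine Submodule.mem_sup_left ?_
        change c * _ ∈ N i
        rw [h1]; exact h
      · refine Submodule.mem_sup_right ?_
        change c * _ ∈ N j
        rw [h1]; exact h)
  have hy' : ∀ j, N j ≤ N i0 → c * y - x j ∈ N j := by
    intro j hj
    have := hy ⟨j, hj⟩
    change c * _ ∈ N j at this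
    rwa [mul_sub, mul_inv_cancel_left₀ hc] at this
  refine ⟨c * y, fun j => ?_⟩
  rcases tot (N j) (N i0) with hj | hj
  · exact hy' j hj
  · have e : c * y - x j = (c * y - x i0) + (x i0 - x j) := by ring
    rw [e]
    refine add_mem (hj (hy' i0 le_rfl)) ?_
    have := hcoh i0 j
    rwa [sup_eq_right.2 hj] at this

/-- `R_L / a` is linearly compact -/
def Gd (K : Type u) [Field K] [Algebra R K] (L : Ideal R) (a : R) : Prop :=
  a ≠ 0 ∧ LCK L ({algebraMap R K a} : Set K)

theorem InL_R {L : Ideal R} [hL : L.IsPrime] (a : R) : InL L (algebraMap R K a) :=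
  ⟨1, fun h => hL.ne_top ((Ideal.eq_top_iff_one L).2 h), a, by simp⟩

theorem Gd_of_notMem {L : Ideal R} {a : R} (ha : a ∉ L) : Gd K L a := by
  refine ⟨fun h => ha (h ▸ L.zero_mem), fun ι x N hst hT hn hcoh => ?_⟩
  have h1 : ∀ i, ∀ k, InL L k → k ∈ N i := by
    rintro i k ⟨s, hs, r, hr⟩
    apply hst i s hs
    rw [hr]
    apply hst i a ha
    have : a • algebraMap R K r = r • algebraMap R K a := by
      rw [Algebra.smul_def, Algebra.smul_def, mul_comm]
    rw [this]
    exact (N i).smul_mem r (hT i _ rfl)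
  rcases isEmpty_or_nonempty ι with he | ⟨⟨i0⟩⟩
  · exact ⟨0, fun i => he.elim i⟩
  · refine ⟨x i0, fun i => ?_⟩
    rcases mem_sup_tot (hcoh i0 i) with h | h
    · exact h1 i _ (hn _ _ h)
    · exact h

theorem Gd_mul {L : Ideal R} [hL : L.IsPrime] {a b : R} (ha : Gd K L a) (hb : Gd K L b) :
    Gd K L (a * b) := by
  refine ⟨mul_ne_zero ha.1 hb.1, fun ι x N hst hT hn hcoh => ?_⟩
  by_cases hall : ∀ i, algebraMap R K a ∈ N i
  · exact ha.2 ι x N hst (fun i t ht => by rw [Set.mem_singleton_iff.1 ht]; exact hall i) hn hcoh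
  push Not at hall
  obtain ⟨i0, hi0⟩ := hall
  have ha0 : algebraMap R K a ≠ 0 := by simpa using ha.1
  refine hb.2.scale ha0 x N hst i0 ?_ ?_ hcoh
  · intro j _ t ht
    rw [Set.mem_singleton_iff.1 ht, ← map_mul]
    exact hT j _ rfl
  · intro n hnn
    obtain ⟨r, rfl⟩ := le_of_notMem hi0 hnn
    rw [Algebra.smul_def, mul_comm, mul_assoc, mul_inv_cancel₀ ha0, mul_one]
    exact InL_R r

theorem Gd_dvd {L : Ideal R} {a b : R} (hab : a ∣ b) (hb : Gd K L b) : Gd K L a := by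
  obtain ⟨c, rfl⟩ := hab
  refine ⟨left_ne_zero_of_mul hb.1, fun ι x N hst hT hn hcoh => hb.2 ι x N hst ?_ hn hcoh⟩
  intro i t ht
  rw [Set.mem_singleton_iff.1 ht, mul_comm a c, map_mul, ← Algebra.smul_def]
  exact (N i).smul_mem c (hT i _ rfl)

/-- the next prime in the chain -/
def J (K : Type u) [Field K] [Algebra R K] [IsFractionRing R K] (L : Ideal R) : Ideal R where
  carrier := {a | ¬ Gd K L a}
  zero_mem' := fun h => h.1 rfl
  add_mem' := by
    intro a b ha hb hab
    rcases ValuationRing.dvd_total a b with h | h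
    · exact ha (Gd_dvd (dvd_add dvd_rfl h) hab)
    · exact hb (Gd_dvd (dvd_add h dvd_rfl) hab)
  smul_mem' := by
    intro c a ha hca
    exact ha (Gd_dvd (Dvd.intro_left c rfl) hca)

theorem mem_J {L : Ideal R} {a : R} : a ∈ J K L ↔ ¬ Gd K L a := Iff.rfl

theorem J_le (L : Ideal R) : J K L ≤ L := by
  intro a ha
  by_contra h
  exact ha (Gd_of_notMem h)

theorem J_prime (L : Ideal R) [hL : L.IsPrime] : (J K L).IsPrime := by
  refine ⟨fun h => hL.ne_top (top_le_iff.1 (h ▸ J_le (K := K) L)), ?_⟩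
  intro a b hab
  by_contra hcon
  push Not at hcon
  rw [mem_J, mem_J, not_not, not_not] at hcon
  exact hab (Gd_mul hcon.1 hcon.2)

/-- composing a maximal `R_L / J` with `R_J / r`. -/
theorem Gd_comp {L J : Ideal R} [hL : L.IsPrime] [hJ : J.IsPrime] (hJL : J ≤ L)
    (h1 : LCK L (algebraMap R K '' J)) {r : R} (h2 : Gd K J r) : Gd K L r := by
  refine ⟨h2.1, fun ι x N hst hT hn hcoh => ?_⟩
  let Nt : ι → Submodule R K := fun i =>
    { carrier := {k | ∃ s, s ∉ J ∧ s • k ∈ N i}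
      zero_mem' := ⟨1, fun h => hJ.ne_top ((Ideal.eq_top_iff_one J).2 h), by simp⟩
      add_mem' := by
        rintro a b ⟨s, hs, hsa⟩ ⟨t, ht, htb⟩
        refine ⟨s * t, fun h => (hJ.mem_or_mem h).elim hs ht, ?_⟩
        rw [smul_add]
        refine add_mem ?_ ?_
        · rw [mul_comm, mul_smul]; exact (N i).smul_mem t hsa
        · rw [mul_smul]; exact (N i).smul_mem s htb
      smul_mem' := by
        rintro c a ⟨s, hs, hsa⟩
        exact ⟨s, hs, by rw [smul_comm]; exact (N i).smul_mem c hsa⟩ }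
  have hone : (1 : R) ∉ J := fun h => hJ.ne_top ((Ideal.eq_top_iff_one J).2 h)
  have hNt : ∀ i, N i ≤ Nt i := fun i k hk => ⟨1, hone, by simpa using hk⟩
  have hNtst : ∀ i, Stab J (Nt i) := by
    rintro i s hs k ⟨t, ht, htk⟩
    exact ⟨t * s, fun h => (hJ.mem_or_mem h).elim ht hs, by rw [mul_smul]; exact htk⟩
  obtain ⟨y, hy⟩ := h2.2 ι x Nt hNtst (fun i t ht => hNt i (hT i t ht)) (by
    rintro i k ⟨s, hs, hk⟩
    obtain ⟨t, ht, r, hr⟩ := hn i _ hk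
    exact ⟨t * s, fun h => (hJ.mem_or_mem h).elim (fun h => ht (hJL h)) hs, r, by
      rw [mul_smul]; exact hr⟩) (fun i j => sup_le_sup (hNt i) (hNt j) (hcoh i j))
  by_cases hcase : ∀ i, ∃ j, Nt j ≤ N i
  · refine ⟨y, fun i => ?_⟩
    obtain ⟨j, hj⟩ := hcase i
    have e : y - x i = (y - x j) + (x j - x i) := by ring
    rw [e]
    refine add_mem (hj (hy j)) ?_
    have := hcoh j i
    rwa [sup_eq_right.2 ((hNt j).trans hj)] at this
  push Not at hcase
  obtain ⟨i0, hi0⟩ := hcase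
  obtain ⟨w, hw, hw'⟩ := SetLike.not_le_iff_exists.1 (hi0 i0)
  have hw0 : w ≠ 0 := by rintro rfl; exact hw' (N i0).zero_mem
  refine h1.scale hw0 x N hst i0 ?_ ?_ hcoh
  · rintro j - _ ⟨q, hq, rfl⟩
    by_contra hcon
    have hle : N i0 ≤ Nt j := (tot (N i0) (Nt j)).resolve_right (hi0 j)
    obtain ⟨s, hs, hsw⟩ := hw
    obtain ⟨t, ht, htw⟩ := hle hsw
    obtain ⟨a, ha⟩ := le_of_notMem hcon htw
    have : t * s = a * q := by
      apply IsFractionRing.injective R K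
      apply mul_right_cancel₀ hw0
      rw [← mul_smul, Algebra.smul_def, Algebra.smul_def] at *
      rw [← ha, map_mul]; ring
    have h3 : t * s ∈ J := by rw [this]; exact J.mul_mem_left a hq
    exact (hJ.mem_or_mem h3).elim ht hs
  · intro n hnn
    obtain ⟨a, rfl⟩ := le_of_notMem hw' hnn
    rw [Algebra.smul_def, mul_comm, mul_assoc, mul_inv_cancel₀ hw0, mul_one]
    exact InL_R a

end prime

end TD

namespace TD

section ext

set_option linter.unusedSectionVars false

variable {R S K F : Type u} [CommRing R] [IsDomain R] [ValuationRing R]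
  [CommRing S] [IsDomain S] [ValuationRing S] [Algebra R S] [Field K] [Field F]
  [Algebra R K] [IsFractionRing R K] [Algebra S F] [IsFractionRing S F] [Algebra K F]
  [Algebra R F] [IsScalarTower R S F] [IsScalarTower R K F]

theorem isUnit_of_ext (hS : IsMaximalImmediateExt R S) {a : R} (h : IsUnit (algebraMap R S a)) :
    IsUnit a := by
  obtain ⟨u, hu⟩ := h
  obtain ⟨r, hr⟩ := hS.2.2.1 ((u⁻¹ : Sˣ) : S)
  by_contra hna
  have h1 : IsUnit (1 - a * r) := by
    apply IsLocalRing.isUnit_one_sub_self_of_mem_nonunits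
    exact fun h => hna (isUnit_of_mul_isUnit_left h)
  apply hr
  have : ((u⁻¹ : Sˣ) : S) - algebraMap R S r = ((u⁻¹ : Sˣ) : S) * algebraMap R S (1 - a * r) := by
    rw [map_sub, map_mul, ← hu, map_one, mul_sub, mul_one, ← mul_assoc, Units.inv_mul, one_mul]
  rw [this]
  exact (Units.isUnit _).mul (h1.map _)

theorem tower (r : R) : algebraMap K F (algebraMap R K r) = algebraMap S F (algebraMap R S r) := by
  rw [← IsScalarTower.algebraMap_apply, ← IsScalarTower.algebraMap_apply]

theorem factor (hS : IsMaximalImmediateExt R S) (x : F) :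
    ∃ (k : K) (u : Sˣ), x = algebraMap K F k * algebraMap S F u := by
  by_cases hx : x = 0
  · exact ⟨0, 1, by simp [hx]⟩
  obtain ⟨a, b, hb, rfl⟩ := IsFractionRing.div_surjective (A := S) x
  have hb0 : b ≠ 0 := nonZeroDivisors.ne_zero hb
  have ha0 : a ≠ 0 := by rintro rfl; simp at hx
  obtain ⟨r, u, rfl⟩ := hS.2.1 a ha0
  obtain ⟨t, v, rfl⟩ := hS.2.1 b hb0
  have ht : algebraMap S F (algebraMap R S t) ≠ 0 := by
    intro h
    apply hx
    rw [map_mul _ (algebraMap R S t), h, zero_mul, div_zero]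
  have hv : algebraMap S F (v : S) ≠ 0 := by
    simp
  refine ⟨algebraMap R K r / algebraMap R K t, u * v⁻¹, ?_⟩
  rw [map_div₀, tower (S := S), tower (S := S), map_mul, map_mul, Units.val_mul, map_mul]
  have : algebraMap S F ((v⁻¹ : Sˣ) : S) = (algebraMap S F (v : S))⁻¹ := by
    apply eq_inv_of_mul_eq_one_left
    rw [← map_mul, Units.inv_mul, map_one]
  rw [this]
  field_simp

theorem int_of_ext (hS : IsMaximalImmediateExt R S) {k : K} {y : S}
    (h : algebraMap K F k = algebraMap S F y) : ∃ r : R, k = algebraMap R K r := by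
  rcases ValuationRing.isInteger_or_isInteger R k with ⟨a, ha⟩ | ⟨a, ha⟩
  · exact ⟨a, ha.symm⟩
  by_cases hk : k = 0
  · exact ⟨0, by simp [hk]⟩
  have h1 : algebraMap R S a * y = 1 := by
    apply IsFractionRing.injective S F
    rw [map_mul, ← h, ← tower (K := K), ha, ← map_mul, inv_mul_cancel₀ hk, map_one, map_one]
  obtain ⟨u, rfl⟩ := isUnit_of_ext hS (IsUnit.of_mul_eq_one _ h1)
  refine ⟨((u⁻¹ : Rˣ) : R), ?_⟩
  have : k = k * (algebraMap R K u * algebraMap R K ((u⁻¹ : Rˣ) : R)) := by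
    rw [← map_mul, Units.mul_inv, map_one, mul_one]
  rw [this, ha, ← mul_assoc, mul_inv_cancel₀ hk, one_mul]

theorem one_notMem {L : Ideal R} (hL : L.IsPrime) : (1 : R) ∉ L :=
  fun h => hL.ne_top ((Ideal.eq_top_iff_one L).2 h)

theorem mul_notMem {L : Ideal R} (hL : L.IsPrime) {s t : R} (hs : s ∉ L) (ht : t ∉ L) :
    s * t ∉ L := fun h => (hL.mem_or_mem h).elim hs ht

/-- the localization of `S` at `L` inside the field `F` -/
def O (S F : Type u) [CommRing S] [IsDomain S] [ValuationRing S] [Algebra R S] [Field F]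
    [Algebra S F] [IsFractionRing S F] (L : Ideal R) [hL : L.IsPrime] : ValuationSubring F where
  carrier := {x | ∃ s, s ∉ L ∧ ∃ y : S, algebraMap S F (algebraMap R S s) * x = algebraMap S F y}
  mul_mem' := by
    rintro a b ⟨s, hs, y, hy⟩ ⟨t, ht, z, hz⟩
    refine ⟨s * t, mul_notMem hL hs ht, y * z, ?_⟩
    rw [map_mul, map_mul, map_mul, ← hy, ← hz]; ring
  one_mem' := ⟨1, one_notMem hL, 1, by simp⟩
  add_mem' := by
    rintro a b ⟨s, hs, y, hy⟩ ⟨t, ht, z, hz⟩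
    refine ⟨s * t, mul_notMem hL hs ht, algebraMap R S t * y + algebraMap R S s * z, ?_⟩
    rw [map_mul, map_mul, map_add, map_mul, map_mul, ← hy, ← hz]; ring
  zero_mem' := ⟨1, one_notMem hL, 0, by simp⟩
  neg_mem' := by
    rintro a ⟨s, hs, y, hy⟩
    exact ⟨s, hs, -y, by rw [map_neg, ← hy, mul_neg]⟩
  mem_or_inv_mem' := by
    intro x
    rcases ValuationRing.isInteger_or_isInteger S x with ⟨a, ha⟩ | ⟨a, ha⟩
    · exact Or.inl ⟨1, one_notMem hL, a, by simp [ha]⟩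
    · exact Or.inr ⟨1, one_notMem hL, a, by simp [ha]⟩

theorem mem_O {L : Ideal R} [hL : L.IsPrime] {x : F} : x ∈ O S F L ↔
    ∃ s, s ∉ L ∧ ∃ y : S, algebraMap S F (algebraMap R S s) * x = algebraMap S F y := Iff.rfl

theorem S_mem_O {L : Ideal R} [hL : L.IsPrime] (y : S) : algebraMap S F y ∈ O S F L :=
  ⟨1, one_notMem hL, y, by simp⟩

theorem O_mono {L J : Ideal R} [hL : L.IsPrime] [hJ : J.IsPrime] (h : J ≤ L) {x : F}
    (hx : x ∈ O S F L) : x ∈ O S F J := by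
  obtain ⟨s, hs, y, hy⟩ := hx
  exact ⟨s, fun h' => hs (h h'), y, hy⟩

theorem mem_O_K (hS : IsMaximalImmediateExt R S) {L : Ideal R} [hL : L.IsPrime] {k : K} :
    algebraMap K F k ∈ O S F L ↔ InL L k := by
  constructor
  · rintro ⟨s, hs, y, hy⟩
    rw [← tower (K := K), ← map_mul] at hy
    obtain ⟨r, hr⟩ := int_of_ext hS hy
    exact ⟨s, hs, r, by rw [Algebra.smul_def, hr]⟩
  · rintro ⟨s, hs, r, hr⟩
    refine ⟨s, hs, algebraMap R S r, ?_⟩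
    rw [← tower (K := K), ← map_mul, ← Algebra.smul_def, hr, tower (S := S)]

theorem val_unit {L : Ideal R} [hL : L.IsPrime] (u : Sˣ) :
    (O S F L).valuation (algebraMap S F u) = 1 := by
  apply le_antisymm
  · exact ((O S F L).valuation_le_one_iff _).2 (S_mem_O _)
  · have h1 : (O S F L).valuation (algebraMap S F ((u⁻¹ : Sˣ) : S)) ≤ 1 :=
      ((O S F L).valuation_le_one_iff _).2 (S_mem_O _)
    have h2 : (O S F L).valuation (algebraMap S F u) *
        (O S F L).valuation (algebraMap S F ((u⁻¹ : Sˣ) : S)) = 1 := by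
      rw [← map_mul, ← map_mul, Units.mul_inv, map_one, map_one]
    calc 1 = _ := h2.symm
      _ ≤ (O S F L).valuation (algebraMap S F u) * 1 := mul_le_mul_right h1 _
      _ = _ := mul_one _

theorem val_surj (hS : IsMaximalImmediateExt R S) (L : Ideal R) [hL : L.IsPrime]
    (γ : (O S F L).ValueGroup) : ∃ c : K, (O S F L).valuation (algebraMap K F c) = γ := by
  obtain ⟨x, rfl⟩ := (O S F L).valuation_surjective γ
  obtain ⟨k, u, rfl⟩ := factor (K := K) hS x
  exact ⟨k, by rw [map_mul, val_unit, mul_one]⟩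

theorem val_LCV (hS : IsMaximalImmediateExt R S) (L : Ideal R) [hL : L.IsPrime] :
    LCV (O S F L).valuation := by
  intro ι U x hU hcoh
  have h0 : ∀ i, 0 ∈ U i := fun i => by
    have := hcoh i i
    rw [sub_self, map_zero] at this
    simpa using this
  obtain ⟨y, hy⟩ := lcF hS.2.2.2 ι (fun i => 
    { carrier := {z : F | (O S F L).valuation z ∈ U i}
      zero_mem' := by simpa using h0 i
      add_mem' := by
        intro a b ha hb
        rcases le_max_iff.1 ((O S F L).valuation.map_add a b) with h | h
        · exact hU i h ha
        · exact hU i h hb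
      smul_mem' := by
        intro s z hz
        refine hU i ?_ hz
        rw [Algebra.smul_def, map_mul]
        calc _ ≤ 1 * _ := mul_le_mul_left (((O S F L).valuation_le_one_iff _).2 (S_mem_O _)) _
          _ = _ := one_mul _ }) x (by
    intro i j
    rcases hcoh i j with h | h
    · exact Submodule.mem_sup_left h
    · exact Submodule.mem_sup_right h)
  exact ⟨y, hy⟩

theorem finDim (hS : IsMaximalImmediateExt R S) (hfin : Module.rank R S < Cardinal.aleph0) :
    FiniteDimensional K F := by
  have b := Module.Free.chooseBasis K F
  choose c u hcu using fun i => factor (K := K) hS (b i)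
  have hli : LinearIndependent K (fun i => algebraMap S F (u i)) := by
    have hc : ∀ i, c i ≠ 0 := by
      intro i h
      have := hcu i
      rw [h, map_zero, zero_mul] at this
      exact b.ne_zero i this
    have := b.linearIndependent.units_smul (fun i => (Units.mk0 (c i) (hc i))⁻¹)
    convert this using 1
    funext i
    simp only [Pi.smul_apply', Units.smul_def]
    rw [hcu i, Algebra.smul_def, ← mul_assoc, ← map_mul]
    simp [hc i]
  have hliR : LinearIndependent R (fun i => (u i : S)) := by
    have h1 : LinearIndependent R (fun i => algebraMap S F (u i)) :=
      (LinearIndependent.iff_fractionRing R K).2 hli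
    exact LinearIndependent.of_comp (IsScalarTower.toAlgHom R S F).toLinearMap h1
  have h2 := hliR.cardinal_le_rank
  have h3 := Cardinal.lt_aleph0_iff_finite.1 (h2.trans_lt hfin)
  exact b.finiteDimensional_of_finite

end ext

end TD

namespace TD

section ext2

set_option linter.unusedSectionVars false

variable {R S K F : Type u} [CommRing R] [IsDomain R] [ValuationRing R]
  [CommRing S] [IsDomain S] [ValuationRing S] [Algebra R S] [Field K] [Field F]
  [Algebra R K] [IsFractionRing R K] [Algebra S F] [IsFractionRing S F] [Algebra K F]
  [Algebra R F] [IsScalarTower R S F] [IsScalarTower R K F]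

theorem val_lt_one (hS : IsMaximalImmediateExt R S) {L : Ideal R} [hL : L.IsPrime] {a : R}
    (ha : a ∈ L) : (O S F L).valuation (algebraMap K F (algebraMap R K a)) < 1 := by
  by_contra hcon
  push Not at hcon
  have h0 : algebraMap R K a ≠ 0 := by
    intro h
    rw [h, map_zero, map_zero] at hcon
    exact absurd hcon (not_le.2 zero_lt_one)
  have h1 : algebraMap K F (algebraMap R K a)⁻¹ ∈ O S F L := by
    rw [← ValuationSubring.valuation_le_one_iff, map_inv₀, map_inv₀]
    exact inv_le_one_of_one_le₀ hcon
  obtain ⟨s, hs, r, hr⟩ := (mem_O_K hS).1 h1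
  apply hs
  have : s = r * a := by
    apply IsFractionRing.injective R K
    rw [map_mul, ← hr, Algebra.smul_def, mul_assoc, inv_mul_cancel₀ h0, mul_one]
  rw [this]
  exact L.mul_mem_left r ha

theorem of_val_lt_one {L : Ideal R} [hL : L.IsPrime] {k : K}
    (hk0 : k ≠ 0) (h : (O S F L).valuation (algebraMap K F k) < 1) :
    ∃ a ∈ L, k = algebraMap R K a := by
  have key : ∀ s : R, s ∉ L → ∀ y : S, algebraMap S F (algebraMap R S s) * (algebraMap K F k)⁻¹ =
      algebraMap S F y → False := by
    intro s hs y hy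
    have h1 : (algebraMap K F k)⁻¹ ∈ O S F L := ⟨s, hs, y, hy⟩
    rw [← ValuationSubring.valuation_le_one_iff, map_inv₀] at h1
    have h2 : (O S F L).valuation (algebraMap K F k) ≠ 0 := by simpa using hk0
    exact absurd ((inv_le_one₀ (zero_lt_iff.2 h2)).1 h1) (not_le.2 h)
  rcases ValuationRing.isInteger_or_isInteger R k with ⟨a, ha⟩ | ⟨a, ha⟩
  · refine ⟨a, ?_, ha.symm⟩
    by_contra hcon
    refine key a hcon 1 ?_
    rw [← tower (K := K), ha, ← map_inv₀, ← map_mul, mul_inv_cancel₀ hk0, map_one, map_one]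
  · exfalso
    refine key 1 (one_notMem hL) (algebraMap R S a) ?_
    rw [← tower (K := K) (r := a), ha]; simp

theorem mem_of_val_le (hS : IsMaximalImmediateExt R S) {L : Ideal R} [hL : L.IsPrime]
    {N : Submodule R K} (hst : Stab L N) {n z : K} (hn : n ∈ N)
    (h : (O S F L).valuation (algebraMap K F z) ≤ (O S F L).valuation (algebraMap K F n)) :
    z ∈ N := by
  by_cases hn0 : n = 0
  · rw [hn0, map_zero, map_zero, le_zero_iff, map_eq_zero, map_eq_zero] at h
    rw [h]; exact N.zero_mem
  have h1 : algebraMap K F (z / n) ∈ O S F L := by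
    rw [← ValuationSubring.valuation_le_one_iff, map_div₀, map_div₀]
    exact div_le_one_of_le₀ h zero_le
  obtain ⟨s, hs, r, hr⟩ := (mem_O_K hS).1 h1
  apply hst s hs
  have : s • z = r • n := by
    rw [Algebra.smul_def] at hr ⊢
    rw [Algebra.smul_def, ← hr]
    field_simp
  rw [this]
  exact N.smul_mem r hn

theorem exists_Gd [FiniteDimensional K F] (hS : IsMaximalImmediateExt R S) {L : Ideal R}
    [hL : L.IsPrime] (hne : L ≠ ⊥) : ∃ a ∈ L, Gd K L a := by
  obtain ⟨a0, ha0, ha0'⟩ := Submodule.exists_mem_ne_zero_of_ne_bot hne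
  have hne0 : (O S F L).valuation (algebraMap K F (algebraMap R K a0)) ≠ 0 := by
    simpa using ha0'
  obtain ⟨ρ, hρ0, hρ1, hρ⟩ := key (K := K) (O S F L).valuation (val_surj hS L) (val_LCV hS L)
    hne0 (val_lt_one hS ha0)
  obtain ⟨k, rfl⟩ := val_surj (K := K) hS L ρ
  have hk0 : k ≠ 0 := by rintro rfl; simp at hρ0
  obtain ⟨a, ha, rfl⟩ := of_val_lt_one hk0 hρ1
  refine ⟨a, ha, by simpa using hk0, ?_⟩
  intro ι x N hst hT hn hcoh
  obtain ⟨y, -, hy⟩ := hρ ι (fun i => {γ | ∃ n ∈ N i, γ ≤ (O S F L).valuation (algebraMap K F n)}) x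
    (by
      rintro i - γ δ hle ⟨n, hn, hγ⟩
      exact ⟨n, hn, hle.trans hγ⟩)
    ⟨_, 1, 1, hρ0, by rw [one_mul, pow_one], by
      rintro i -
      refine ⟨⟨_, hT i _ rfl, le_rfl⟩, ?_⟩
      rintro u ⟨n, hnn, hu⟩
      refine hu.trans ?_
      rw [ValuationSubring.valuation_le_one_iff, mem_O_K hS]
      exact hn i n hnn⟩ (fun _ _ => trivial) (by
      intro i _ j _
      rcases mem_sup_tot (hcoh i j) with h | h
      · exact Or.inl ⟨_, h, le_rfl⟩
      · exact Or.inr ⟨_, h, le_rfl⟩)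
  refine ⟨y, fun i => ?_⟩
  obtain ⟨n, hnn, hle⟩ := hy i trivial
  exact mem_of_val_le hS (hst i) hnn hle

theorem J_lt [FiniteDimensional K F] (hS : IsMaximalImmediateExt R S) {L : Ideal R}
    [hL : L.IsPrime] (hne : L ≠ ⊥) : J K L < L := by
  refine lt_of_le_of_ne (J_le L) fun h => ?_
  obtain ⟨a, ha, hg⟩ := exists_Gd (K := K) (F := F) hS hne
  rw [← h] at ha
  exact ha hg

end ext2

end TD

namespace TD

section ext3

set_option linter.unusedSectionVars false

variable {R S K F : Type u} [CommRing R] [IsDomain R] [ValuationRing R]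
  [CommRing S] [IsDomain S] [ValuationRing S] [Algebra R S] [Field K] [Field F]
  [Algebra R K] [IsFractionRing R K] [Algebra S F] [IsFractionRing S F] [Algebra K F]
  [Algebra R F] [IsScalarTower R S F] [IsScalarTower R K F]

/-- `b` is an orthogonal system for the localization at `L`, starting with `1` -/
def Orth (K S : Type u) {F : Type u} [Field K] [CommRing S] [IsDomain S] [ValuationRing S]
    [Algebra R S] [Field F] [Algebra S F] [IsFractionRing S F] [Algebra K F]
    (L : Ideal R) [L.IsPrime] (t : ℕ) (b : Fin (t + 1) → F) : Prop :=
  b 0 = 1 ∧ (∀ j, b j ∈ O S F L) ∧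
    ∀ c : Fin (t + 1) → K, ∑ j, c j • b j ∈ O S F L → ∀ j, algebraMap K F (c j) ∈ O S F L

theorem orth_one (L : Ideal R) [L.IsPrime] : Orth K S (F := F) L 0 (fun _ => 1) := by
  refine ⟨rfl, fun _ => ValuationSubring.one_mem _, fun c hc j => ?_⟩
  obtain rfl : j = 0 := Fin.fin_one_eq_zero j
  simpa [Algebra.smul_def] using hc

theorem O_div {L : Ideal R} [hL : L.IsPrime] {s : R} (hs : s ∉ L) {x : F}
    (h : algebraMap S F (algebraMap R S s) * x ∈ O S F L) : x ∈ O S F L := by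
  obtain ⟨t, ht, y, hy⟩ := h
  exact ⟨t * s, mul_notMem hL ht hs, y, by rw [map_mul, map_mul, mul_assoc, hy]⟩

theorem orth_mono {L J : Ideal R} [hL : L.IsPrime] [hJ : J.IsPrime] (h : J ≤ L) {t : ℕ}
    {b : Fin (t + 1) → F} (hb : Orth K S L t b) : Orth K S J t b := by
  refine ⟨hb.1, fun j => O_mono h (hb.2.1 j), fun c hc j => ?_⟩
  obtain ⟨s, hs, y, hy⟩ := hc
  have := hb.2.2 (fun j => algebraMap R K s * c j) (by
    have e : ∑ j, (algebraMap R K s * c j) • b j = algebraMap S F y := by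
      rw [← hy, Finset.mul_sum]
      refine Finset.sum_congr rfl fun j _ => ?_
      rw [Algebra.smul_def, Algebra.smul_def, map_mul, tower (S := S), mul_assoc]
    rw [e]; exact S_mem_O y) j
  rw [map_mul, tower (S := S)] at this
  exact O_div hs (O_mono h this)

theorem orth_card [FiniteDimensional K F] (hS : IsMaximalImmediateExt R S) {L : Ideal R}
    [hL : L.IsPrime] (hne : L ≠ ⊥) {t : ℕ} {b : Fin (t + 1) → F} (hb : Orth K S L t b) :
    t + 1 ≤ Module.finrank K F := by
  have : LinearIndependent K b := by
    rw [Fintype.linearIndependent_iff]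
    intro c hc j
    by_contra hcj
    obtain ⟨a, ha, ha0⟩ := Submodule.exists_mem_ne_zero_of_ne_bot hne
    have ha0' : algebraMap R K a ≠ 0 := by simpa using ha0
    have h1 := hb.2.2 (fun i => ((c j)⁻¹ * (algebraMap R K a)⁻¹) * c i) (by
      have : ∑ i, (((c j)⁻¹ * (algebraMap R K a)⁻¹) * c i) • b i = 0 := by
        simp_rw [mul_smul]
        rw [← Finset.smul_sum, ← Finset.smul_sum, hc, smul_zero, smul_zero]
      rw [this]; exact ValuationSubring.zero_mem _) j
    have e : (c j)⁻¹ * (algebraMap R K a)⁻¹ * c j = (algebraMap R K a)⁻¹ := by field_simp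
    simp only [e] at h1
    have h2 := val_lt_one (K := K) (F := F) hS ha
    rw [← ValuationSubring.valuation_le_one_iff, map_inv₀, map_inv₀] at h1
    have h3 : (O S F L).valuation (algebraMap K F (algebraMap R K a)) ≠ 0 := by simpa using ha0
    exact absurd ((inv_le_one₀ (zero_lt_iff.2 h3)).1 h1) (not_le.2 h2)
  simpa using this.fintype_card_le_finrank

theorem orth_ext {L : Ideal R} [hL : L.IsPrime] {t : ℕ}
    {b : Fin (t + 1) → F} (hb : Orth K S L t b) {y : F} (hy : y ∈ O S F L)
    (hno : ¬ Orth K S L (t + 1) (Fin.snoc b y : Fin (t + 1 + 1) → F)) :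
    ∃ e : Fin (t + 1) → K, ∃ q ∈ L, ∃ s : S,
      y = ∑ j, e j • b j + algebraMap K F (algebraMap R K q) * algebraMap S F s := by
  have h1 : ∃ c : Fin (t + 1) → K, ∃ d : K, ∑ j, c j • b j + d • y ∈ O S F L ∧
      algebraMap K F d ∉ O S F L := by
    by_contra hcon
    push Not at hcon
    apply hno
    refine ⟨?_, ?_, ?_⟩
    · have : (0 : Fin (t + 1 + 1)) = Fin.castSucc 0 := rfl
      rw [this, Fin.snoc_castSucc]; exact hb.1
    · intro j
      refine Fin.lastCases ?_ (fun j => ?_) j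
      · rw [Fin.snoc_last]; exact hy
      · rw [Fin.snoc_castSucc]; exact hb.2.1 j
    · intro c hc
      rw [Fin.sum_univ_castSucc] at hc
      simp only [Fin.snoc_castSucc, Fin.snoc_last] at hc
      have hd := hcon _ _ hc
      have h2 : ∑ j : Fin (t + 1), c j.castSucc • b j ∈ O S F L := by
        have h3 : c (Fin.last (t + 1)) • y ∈ O S F L := by
          rw [Algebra.smul_def]; exact ValuationSubring.mul_mem _ _ _ hd hy
        have := sub_mem hc h3
        rwa [add_sub_cancel_right] at this
      intro j
      exact Fin.lastCases hd (fun j => hb.2.2 _ h2 j) j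
  obtain ⟨c, d, hσ, hd⟩ := h1
  have hd0 : d ≠ 0 := by
    rintro rfl
    exact hd (by rw [map_zero]; exact ValuationSubring.zero_mem _)
  have hdF : algebraMap K F d ≠ 0 := by simpa using hd0
  obtain ⟨q, hq, hdq⟩ := of_val_lt_one (S := S) (F := F) (L := L) (inv_ne_zero hd0) (by
    rw [← ValuationSubring.valuation_le_one_iff, not_le] at hd
    rw [map_inv₀, map_inv₀]
    exact inv_lt_one_of_one_lt₀ hd)
  obtain ⟨s, hs, y', hy'⟩ := hσ
  obtain ⟨q', rfl⟩ : s ∣ q := (ValuationRing.dvd_total s q).resolve_right fun h =>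
    hs (L.mem_of_dvd h hq)
  have hq' : q' ∈ L := (hL.mem_or_mem hq).resolve_left hs
  refine ⟨fun j => -(d⁻¹ * c j), q', hq', y', ?_⟩
  rw [← hy', tower (S := S), ← mul_assoc]
  have h4 : (algebraMap S F) ((algebraMap R S) q') * (algebraMap S F) ((algebraMap R S) s) =
      (algebraMap K F d)⁻¹ := by
    rw [← map_inv₀, hdq, tower (S := S), map_mul, map_mul, mul_comm]
  rw [h4]
  have h5 : ∑ j, (-(d⁻¹ * c j)) • b j = - ((algebraMap K F d)⁻¹ * ∑ j, c j • b j) := by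
    rw [Finset.mul_sum, ← Finset.sum_neg_distrib]
    refine Finset.sum_congr rfl fun j _ => ?_
    rw [neg_smul, mul_smul, Algebra.smul_def d⁻¹, map_inv₀]
  rw [h5, mul_add, neg_add_cancel_left, Algebra.smul_def, inv_mul_cancel_left₀ hdF]

/-- extension of a submodule of `K` to `F` -/
def Wx (S F : Type u) [CommRing S] [IsDomain S] [ValuationRing S] [Algebra R S] [Field F]
    [Algebra S F] [IsFractionRing S F] [Algebra K F] [Algebra R F] [IsScalarTower R S F]
    [IsScalarTower R K F] (N : Submodule R K) : Submodule S F where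
  carrier := {x | ∃ n ∈ N, ∃ s : S, x = algebraMap K F n * algebraMap S F s}
  zero_mem' := ⟨0, N.zero_mem, 0, by simp⟩
  add_mem' := by
    have key : ∀ (n : K) (s : S) (r : R) (s' : S), algebraMap K F n * algebraMap S F s +
        algebraMap K F (r • n) * algebraMap S F s' =
        algebraMap K F n * algebraMap S F (s + algebraMap R S r * s') := by
      intro n s r s'
      rw [Algebra.smul_def, map_mul, tower (S := S), map_add, map_mul]; ring
    rintro _ _ ⟨n, hn, s, rfl⟩ ⟨n', hn', s', rfl⟩
    rcases tot (Submodule.span R {n}) (Submodule.span R {n'}) with h | h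
    · obtain ⟨r, rfl⟩ := Submodule.mem_span_singleton.1 (h (Submodule.mem_span_singleton_self n))
      rw [add_comm]
      exact ⟨_, hn', _, key _ _ _ _⟩
    · obtain ⟨r, rfl⟩ := Submodule.mem_span_singleton.1 (h (Submodule.mem_span_singleton_self n'))
      exact ⟨_, hn, _, key _ _ _ _⟩
  smul_mem' := by
    rintro a _ ⟨n, hn, s, rfl⟩
    exact ⟨n, hn, a * s, by rw [Algebra.smul_def, map_mul]; ring⟩

theorem orth_W (hS : IsMaximalImmediateExt R S) {L : Ideal R} [hL : L.IsPrime] {t : ℕ}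
    {b : Fin (t + 1) → F} (hb : Orth K S L t b) {N : Submodule R K} (hst : Stab L N) {n' : K}
    (hn' : n' ∈ N) (hn0' : n' ≠ 0) {e : Fin (t + 1) → K} (h : ∑ j, e j • b j ∈ Wx S F N)
    (j : Fin (t + 1)) : e j ∈ N := by
  have h1 : ∃ n ∈ N, n ≠ 0 ∧ ∃ s : S, ∑ j, e j • b j = algebraMap K F n * algebraMap S F s := by
    obtain ⟨n, hn, s, hs⟩ := h
    by_cases hn0 : n = 0
    · exact ⟨n', hn', hn0', 0, by rw [hs, hn0]; simp⟩
    · exact ⟨n, hn, hn0, s, hs⟩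
  obtain ⟨n, hn, hn0, s, hs⟩ := h1
  have hnF : algebraMap K F n ≠ 0 := by simpa using hn0
  have h2 := hb.2.2 (fun j => n⁻¹ * e j) (by
    simp_rw [mul_smul]
    rw [← Finset.smul_sum, hs, Algebra.smul_def, map_inv₀, inv_mul_cancel_left₀ hnF]
    exact S_mem_O s) j
  refine mem_of_val_le (S := S) (F := F) hS hst hn ?_
  rw [← ValuationSubring.valuation_le_one_iff, map_mul, map_mul, map_inv₀, map_inv₀] at h2
  have h3 : (O S F L).valuation (algebraMap K F n) ≠ 0 := by simpa using hn0
  rwa [inv_mul_le_one₀ (zero_lt_iff.2 h3)] at h2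

theorem lck_of_noext (hS : IsMaximalImmediateExt R S) {L J : Ideal R} [hL : L.IsPrime]
    [hJ : J.IsPrime] (hJL : J ≤ L) (hJne : J ≠ ⊥) {t : ℕ}
    {b : Fin (t + 1) → F} (hb : Orth K S L t b)
    (hno : ∀ y : F, ¬ Orth K S J (t + 1) (Fin.snoc b y : Fin (t + 1 + 1) → F)) :
    LCK L (algebraMap R K '' J) := by
  intro ι x N hst hT hn hcoh
  rcases isEmpty_or_nonempty ι with he | ⟨⟨i0⟩⟩
  · exact ⟨0, fun i => he.elim i⟩
  obtain ⟨a, ha, ha0⟩ := Submodule.exists_mem_ne_zero_of_ne_bot hJne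
  have hW : ∀ i, ∀ n ∈ N i, algebraMap K F n ∈ Wx S F (N i) := fun i n hn => ⟨n, hn, 1, by simp⟩
  obtain ⟨X, hX⟩ := lcF hS.2.2.2 ι (fun i => Wx S F (N i)) (fun i => algebraMap K F (x i)) (by
    intro i j
    rw [← map_sub]
    rcases mem_sup_tot (hcoh i j) with h | h
    · exact Submodule.mem_sup_left (hW _ _ h)
    · exact Submodule.mem_sup_right (hW _ _ h))
  have hyO : X - algebraMap K F (x i0) ∈ O S F J := by
    obtain ⟨n, hnn, s, hs⟩ := hX i0
    rw [hs]
    exact O_mono hJL (ValuationSubring.mul_mem _ _ _ ((mem_O_K hS).2 (hn i0 n hnn)) (S_mem_O s))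
  obtain ⟨e, q, hq, s, hs⟩ := orth_ext (orth_mono hJL hb) hyO (hno _)
  refine ⟨e 0 + x i0, fun i => ?_⟩
  have h1 : ∑ j, (e j - (Pi.single 0 (x i - x i0) : Fin (t + 1) → K) j) • b j ∈ Wx S F (N i) := by
    have h2 : ∑ j, (e j - (Pi.single 0 (x i - x i0) : Fin (t + 1) → K) j) • b j =
        (X - algebraMap K F (x i)) -
          algebraMap K F (algebraMap R K q) * algebraMap S F s := by
      have h3 : ∑ j, (Pi.single 0 (x i - x i0) : Fin (t + 1) → K) j • b j =
          algebraMap K F (x i - x i0) := by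
        rw [Finset.sum_eq_single 0]
        · rw [Pi.single_eq_same, hb.1, Algebra.smul_def, mul_one]
        · intro j _ hj
          rw [Pi.single_eq_of_ne hj, zero_smul]
        · simp
      simp_rw [sub_smul]
      rw [Finset.sum_sub_distrib, h3, map_sub]
      rw [sub_eq_iff_eq_add] at hs
      rw [hs]; ring
    rw [h2]
    exact sub_mem (hX i) ⟨_, hT i _ ⟨q, hq, rfl⟩, s, rfl⟩
  have := orth_W hS hb (hst i) (hT i _ ⟨a, ha, rfl⟩) (by simpa using ha0) h1 0
  rw [Pi.single_eq_same] at this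
  have e' : e 0 + x i0 - x i = e 0 - (x i - x i0) := by ring
  rw [e']; exact this

theorem step [FiniteDimensional K F] (hS : IsMaximalImmediateExt R S) {L : Ideal R}
    [hL : L.IsPrime] [hJ : (J K L).IsPrime] (hJne : J K L ≠ ⊥) {t : ℕ}
    {b : Fin (t + 1) → F} (hb : Orth K S L t b) :
    ∃ b' : Fin (t + 1 + 1) → F, Orth K S (J K L) (t + 1) b' := by
  by_contra hcon
  push Not at hcon
  have h1 := lck_of_noext hS (J_le L) hJne hb (fun y => hcon _)
  obtain ⟨r, hr, hg⟩ := exists_Gd (K := K) (F := F) hS hJne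
  exact hr (Gd_comp (J_le L) h1 hg)

end ext3

end TD

namespace TD

section am

variable {R : Type u} [CommRing R] [IsDomain R] [ValuationRing R] {K : Type u} [Field K]
  [Algebra R K] [IsFractionRing R K]

theorem am_aux (L : Ideal R) [hL : L.IsPrime] {Rl : Type u} [CommRing Rl] [Algebra R Rl]
    [IsLocalization.AtPrime Rl L] (I : Ideal Rl) (hI : I = Ideal.map (algebraMap R Rl) (J K L)) :
    AlmostMaximalRing (Rl ⧸ I) := by
  intro A hA ι a N hfin
  have hunit : ∀ y : L.primeCompl, IsUnit (algebraMap R K y) := by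
    intro y
    rw [isUnit_iff_ne_zero]
    intro h
    have : (y : R) = 0 := by simpa using h
    exact y.2 (this ▸ L.zero_mem)
  obtain ⟨ψ, hψ⟩ : ∃ ψ : Rl →+* K, ∀ r, ψ (algebraMap R Rl r) = algebraMap R K r :=
    ⟨IsLocalization.lift (M := L.primeCompl) hunit, fun r => IsLocalization.lift_eq hunit r⟩
  have hspec : ∀ z : Rl, ∃ r : R, ∃ s : L.primeCompl, z * algebraMap R Rl s = algebraMap R Rl r ∧
      z = algebraMap R Rl r * IsLocalization.mk' Rl (1 : R) s := by
    intro z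
    obtain ⟨r, s, rfl⟩ := IsLocalization.exists_mk'_eq L.primeCompl z
    refine ⟨r, s, IsLocalization.mk'_spec _ _ _, ?_⟩
    rw [IsLocalization.mul_mk'_eq_mk'_of_mul, mul_one]
  have hinv : ∀ s : L.primeCompl, ψ (IsLocalization.mk' Rl (1 : R) s) * algebraMap R K s = 1 := by
    intro s
    rw [← hψ, ← map_mul, IsLocalization.mk'_spec, hψ, map_one]
  have hs0 : ∀ s : L.primeCompl, algebraMap R K s ≠ 0 := fun s => (hunit s).ne_zero
  have hinj : Function.Injective ψ := by
    rw [injective_iff_map_eq_zero]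
    intro z hz
    obtain ⟨r, s, h1, h2⟩ := hspec z
    have h3 : algebraMap R K r = 0 := by rw [← hψ, ← h1, map_mul, hz, zero_mul]
    have h4 : r = 0 := by simpa using h3
    rw [h2, h4, map_zero, zero_mul]
  have hInL : ∀ z, InL L (ψ z) := by
    intro z
    obtain ⟨r, s, h1, -⟩ := hspec z
    exact ⟨s, s.2, r, by rw [Algebra.smul_def, ← hψ, ← hψ, ← h1, map_mul, mul_comm]⟩
  let π : Rl → (Rl ⧸ I) ⧸ A := fun z => Ideal.Quotient.mk A (Ideal.Quotient.mk I z)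
  have hπadd : ∀ z z', π (z + z') = π z + π z' := fun z z' => by simp [π]
  have hπsub : ∀ z z', π (z - z') = π z - π z' := fun z z' => by simp [π]
  have hπmul : ∀ z z', π (z * z') = (Ideal.Quotient.mk I z) • π z' := fun z z' => by
    simp only [π, map_mul]; rfl
  have hπsurj : Function.Surjective π := by
    intro x
    obtain ⟨y, rfl⟩ := Ideal.Quotient.mk_surjective x
    obtain ⟨z, rfl⟩ := Ideal.Quotient.mk_surjective y
    exact ⟨z, rfl⟩
  obtain ⟨c, hc, hcA⟩ : ∃ c : R, Gd K L c ∧ π (algebraMap R Rl c) = 0 := by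
    obtain ⟨q, hq, hq0⟩ := Submodule.exists_mem_ne_zero_of_ne_bot hA
    obtain ⟨z, rfl⟩ := Ideal.Quotient.mk_surjective q
    obtain ⟨r, s, h1, h2⟩ := hspec z
    refine ⟨r, ?_, ?_⟩
    · by_contra hr
      apply hq0
      rw [Ideal.Quotient.eq_zero_iff_mem, h2]
      refine I.mul_mem_right _ ?_
      rw [hI]
      exact (Ideal.mem_map_of_mem _ hr)
    · rw [← h1]
      simp only [π]
      rw [Ideal.Quotient.eq_zero_iff_mem, map_mul]
      exact A.mul_mem_right _ hq
  let N' : ι → Submodule R K := fun i =>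
    { carrier := {k | ∃ z, ψ z = k ∧ π z ∈ N i}
      zero_mem' := ⟨0, map_zero _, by simp [π]⟩
      add_mem' := by
        rintro _ _ ⟨z, rfl, hz⟩ ⟨z', rfl, hz'⟩
        exact ⟨z + z', map_add _ _ _, by rw [hπadd]; exact add_mem hz hz'⟩
      smul_mem' := by
        rintro r _ ⟨z, rfl, hz⟩
        exact ⟨algebraMap R Rl r * z, by rw [map_mul, hψ, Algebra.smul_def], by
          rw [hπmul]; exact (N i).smul_mem _ hz⟩ }
  choose z hz using fun i => hπsurj (a i)
  obtain ⟨y, hy⟩ := hc.2 ι (fun i => ψ (z i)) N' (by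
      rintro i s hs k ⟨w, hw, hwN⟩
      refine ⟨IsLocalization.mk' Rl (1 : R) (⟨s, hs⟩ : L.primeCompl) * w, ?_, by
        rw [hπmul]; exact (N i).smul_mem _ hwN⟩
      have := hinv ⟨s, hs⟩
      rw [map_mul, hw, Algebra.smul_def, ← mul_assoc, this, one_mul]) (by
      rintro i t rfl
      exact ⟨_, hψ c, by rw [hcA]; exact (N i).zero_mem⟩) (by
      rintro i _ ⟨w, rfl, -⟩
      exact hInL w) (by
      classical
      intro i j
      obtain ⟨X, hX⟩ := hfin {i, j}
      obtain ⟨w, rfl⟩ := hπsurj X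
      have e : ψ (z i) - ψ (z j) = - ψ (w - z i) + ψ (w - z j) := by
        rw [map_sub, map_sub]; ring
      rw [e]
      refine add_mem (neg_mem (Submodule.mem_sup_left ⟨_, rfl, ?_⟩))
        (Submodule.mem_sup_right ⟨_, rfl, ?_⟩)
      · rw [hπsub, hz]; exact hX i (by simp)
      · rw [hπsub, hz]; exact hX j (by simp))
  rcases isEmpty_or_nonempty ι with he | ⟨⟨i0⟩⟩
  · exact ⟨0, fun i => he.elim i⟩
  obtain ⟨w, hw, -⟩ := hy i0
  refine ⟨π (w + z i0), fun i => ?_⟩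
  obtain ⟨w', hw', hN⟩ := hy i
  have : w' = w + z i0 - z i := by
    apply hinj
    rw [hw', map_sub, map_add, hw]; ring
  rw [this, hπsub, hz] at hN
  exact hN

theorem am (K : Type u) [Field K] [Algebra R K] [IsFractionRing R K] (L : Ideal R)
    (hL : L.IsPrime) :
    AlmostMaximalRing ((@Localization.AtPrime R _ L hL) ⧸
      Ideal.map (algebraMap R (@Localization.AtPrime R _ L hL)) (J K L)) :=
  am_aux L _ rfl

end am

section chain

set_option linter.unusedSectionVars false

variable {R S K F : Type u} [CommRing R] [IsDomain R] [ValuationRing R]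
  [CommRing S] [IsDomain S] [ValuationRing S] [Algebra R S] [Field K] [Field F]
  [Algebra R K] [IsFractionRing R K] [Algebra S F] [IsFractionRing S F] [Algebra K F]
  [Algebra R F] [IsScalarTower R S F] [IsScalarTower R K F]

/-- `R_L / L'` is almost maximal -/
def AM (L L' : Ideal R) : Prop := ∀ hL : L.IsPrime,
  AlmostMaximalRing ((@Localization.AtPrime R _ L hL) ⧸
      Ideal.map (algebraMap R (@Localization.AtPrime R _ L hL)) L')

theorem chain [FiniteDimensional K F] (hS : IsMaximalImmediateExt R S) (n : ℕ) :
    ∀ (L : Ideal R) (hL : L.IsPrime), L ≠ ⊥ → ∀ (t : ℕ) (b : Fin (t + 1) → F), Orth K S L t b →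
      Module.finrank K F ≤ n + t →
      ∃ (m : ℕ) (c : Fin (m + 1) → Ideal R), c 0 = L ∧ (∀ k, (c k).IsPrime) ∧ StrictAnti c ∧
        (∀ k : Fin m, AM (c k.castSucc) (c k.succ)) ∧ c (Fin.last m) = ⊥ := by
  induction n with
  | zero =>
    intro L hL hne t b hb hle
    have := orth_card hS hne hb
    omega
  | succ n ih =>
    intro L hL hne t b hb hle
    have hJ : (J K L).IsPrime := J_prime L
    have hlt : J K L < L := J_lt (F := F) hS hne
    have h1 : ∃ (m : ℕ) (c : Fin (m + 1) → Ideal R), c 0 = J K L ∧ (∀ k, (c k).IsPrime) ∧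
        StrictAnti c ∧ (∀ k : Fin m, AM (c k.castSucc) (c k.succ)) ∧ c (Fin.last m) = ⊥ := by
      by_cases hbot : J K L = ⊥
      · exact ⟨0, fun _ => J K L, rfl, fun _ => hJ, fun i j h => by omega,
          fun k => k.elim0, hbot⟩
      · obtain ⟨b', hb'⟩ := step hS hbot hb
        exact ih (J K L) hJ hbot (t + 1) b' hb' (by omega)
    obtain ⟨m, c, hc0, hcp, hca, hcm, hcl⟩ := h1
    refine ⟨m + 1, Fin.cons L c, by simp, ?_, ?_, ?_, ?_⟩
    · intro k
      refine Fin.cases ?_ (fun k => ?_) k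
      · simpa using hL
      · simpa using hcp k
    · rw [Fin.strictAnti_iff_succ_lt]
      intro k
      refine Fin.cases ?_ (fun k => ?_) k
      · simpa [hc0] using hlt
      · rw [← Fin.succ_castSucc, Fin.cons_succ, Fin.cons_succ]
        exact hca Fin.castSucc_lt_succ
    · intro k
      refine Fin.cases ?_ (fun k => ?_) k
      · rw [Fin.castSucc_zero, Fin.cons_zero, Fin.cons_succ, hc0]
        exact fun hp => am K L hp
      · rw [← Fin.succ_castSucc, Fin.cons_succ, Fin.cons_succ]
        exact hcm k
    · rw [← Fin.succ_last, Fin.cons_succ]; exact hcl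

end chain

end TD

theorem stmt_7 (R S : Type u) [CommRing R] [IsDomain R] [ValuationRing R]
    [CommRing S] [IsDomain S] [ValuationRing S] [Algebra R S]
    (hS : IsMaximalImmediateExt R S) (hfin : Module.rank R S < Cardinal.aleph0) :
    ∃ (m : ℕ) (L : Fin (m + 1) → Ideal R) (hp : ∀ k, (L k).IsPrime),
      L 0 = IsLocalRing.maximalIdeal R ∧ StrictAnti L ∧
      (∀ k : Fin m,
        AlmostMaximalRing
          ((@Localization.AtPrime R _ (L k.castSucc) (hp k.castSucc)) ⧸
            Ideal.map (algebraMap R (@Localization.AtPrime R _ (L k.castSucc) (hp k.castSucc)))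
              (L k.succ))) ∧
      (L (Fin.last m) ≠ ⊥ →
        MaximalRing (@Localization.AtPrime R _ (L (Fin.last m)) (hp (Fin.last m)))) := by
  classical
  by_cases hne : IsLocalRing.maximalIdeal R = ⊥
  · refine ⟨0, fun _ => IsLocalRing.maximalIdeal R, fun _ => inferInstance, rfl,
      fun i j h => by omega, fun k => k.elim0, fun h => absurd hne h⟩
  have : FaithfulSMul R S := (faithfulSMul_iff_algebraMap_injective R S).2 hS.1
  letI : Algebra (FractionRing R) (FractionRing S) := FractionRing.liftAlgebra R (FractionRing S)
  have := FractionRing.isScalarTower_liftAlgebra R (FractionRing S)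
  have : FiniteDimensional (FractionRing R) (FractionRing S) := TD.finDim hS hfin
  obtain ⟨m, c, hc0, hcp, hca, hcm, hcl⟩ :=
    TD.chain (K := FractionRing R) (F := FractionRing S) hS
      (Module.finrank (FractionRing R) (FractionRing S)) (IsLocalRing.maximalIdeal R) inferInstance
      hne 0 (fun _ => 1) (TD.orth_one _) le_rfl
  exact ⟨m, c, hcp, hc0, hca, fun k => hcm k _, fun h => absurd hcl h⟩
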